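/- Let G be a countable discrete group. The following are equivalent: (i) G is amenable; (ii) there exists an infinite abelian group A such that the wreath product A≀G is unitarizable; (iii) for every amenable discrete group A, the wreath product A≀G is unitarizable. -/

import Mathlib

/-- A discrete group `G` is amenable: there exists a left-invariant mean on the
bounded real-valued functions on `G`. -/
def IsAmenable (G : Type*) [Group G] : Prop :=
  ∃ m : (G → ℝ) → ℝ,
    (∀ f₁ f₂ : G → ℝ, (∃ C, ∀ x, |f₁ x| ≤ C) → (∃ C, ∀ x, |f₂ x| ≤ C) →
      m (f₁ + f₂) = m f₁ + m f₂) ∧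
    (∀ (c : ℝ) (f : G → ℝ), (∃ C, ∀ x, |f x| ≤ C) → m (c • f) = c * m f) ∧
    (∀ f : G → ℝ, (∃ C, ∀ x, |f x| ≤ C) → (∀ x, 0 ≤ f x) → 0 ≤ m f) ∧
    m 1 = 1 ∧
    (∀ (g : G) (f : G → ℝ), (∃ C, ∀ x, |f x| ≤ C) → m (fun t => f (g⁻¹ * t)) = m f)

/-- A discrete group `G` is unitarizable if every uniformly bounded representation of `G`
on every complex Hilbert space is unitarizable. -/
def IsUnitarizableGroup (G : Type*) [Group G] : Prop :=
  ∀ (H : Type) [NormedAddCommGroup H] [InnerProductSpace ℂ H] [CompleteSpace H]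
    (π : G →* (H →L[ℂ] H)ˣ),
    (∃ C : ℝ, ∀ g : G, ‖(π g : H →L[ℂ] H)‖ ≤ C) →
    ∃ S : (H →L[ℂ] H)ˣ, ∀ g : G,
      ((S⁻¹ * π g * S : (H →L[ℂ] H)ˣ) : H →L[ℂ] H) ∈ unitary (H →L[ℂ] H)

/-- `A^{(G)}`: the direct sum of copies of `A` indexed by `G`, realized as the subgroup
of `G → A` consisting of finitely supported functions (pointwise product). -/
def finSupp (G A : Type*) [Group A] : Subgroup (G → A) where
  carrier := {a | {t | a t ≠ 1}.Finite}
  one_mem' := by simp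
  mul_mem' := by
    intro a b ha hb
    refine (ha.union hb).subset fun t ht => ?_
    by_contra hc
    simp only [Set.mem_union, Set.mem_setOf_eq, not_or, not_not] at hc
    exact ht (show a t * b t = 1 by rw [hc.1, hc.2, one_mul])
  inv_mem' := by
    intro a ha
    refine ha.subset fun t ht => ?_
    simp only [Set.mem_setOf_eq] at ht ⊢
    exact fun h => ht (show a⁻¹ t = 1 by simp only [Pi.inv_apply, h, inv_one])

/-- The shift by `g ∈ G` on `A^{(G)}`: `(g·a)(t) = a(g⁻¹t)`, as a group automorphism. -/
def shiftEquiv (A G : Type*) [Group A] [Group G] (g : G) :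
    ↥(finSupp G A) ≃* ↥(finSupp G A) where
  toFun a := ⟨fun t => (a : G → A) (g⁻¹ * t), by
    refine ((a.2.image (fun t => g * t)).subset ?_)
    intro t ht
    exact ⟨g⁻¹ * t, ht, by group⟩⟩
  invFun a := ⟨fun t => (a : G → A) (g * t), by
    refine ((a.2.image (fun t => g⁻¹ * t)).subset ?_)
    intro t ht
    exact ⟨g * t, ht, by group⟩⟩
  left_inv a := Subtype.ext (funext fun t => by simp)
  right_inv a := Subtype.ext (funext fun t => by simp)
  map_mul' a b := rfl

/-- The shift action of `G` on `A^{(G)}` as a homomorphism `G →* Aut(A^{(G)})`. -/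
def shiftHom (A G : Type*) [Group A] [Group G] : G →* MulAut ↥(finSupp G A) where
  toFun g := shiftEquiv A G g
  map_one' := by
    ext a t
    simp [shiftEquiv]
  map_mul' g₁ g₂ := by
    ext a t
    simp [shiftEquiv, mul_assoc]

/-- The wreath product `A ≀ G = A^{(G)} ⋊ G`. -/
abbrev Wreath (A G : Type*) [Group A] [Group G] :=
  (finSupp G A) ⋊[shiftHom A G] G

open Filter Topology

/-- A function is bounded. -/
def IsBddFun {X : Type*} (f : X → ℝ) : Prop := ∃ C, ∀ x, |f x| ≤ C

/-- A mean (finitely additive probability) on the bounded functions on a set. -/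
structure IsMean {X : Type*} (m : (X → ℝ) → ℝ) : Prop where
  add : ∀ f g, IsBddFun f → IsBddFun g → m (f + g) = m f + m g
  smul : ∀ (c : ℝ) f, IsBddFun f → m (c • f) = c * m f
  nonneg : ∀ f, IsBddFun f → (∀ x, 0 ≤ f x) → 0 ≤ m f
  one : m 1 = 1

/-- A mean is invariant under left translation by `g`. -/
def IsInvUnder {G : Type*} [Group G] (m : (G → ℝ) → ℝ) (g : G) : Prop :=
  ∀ f, IsBddFun f → m (fun t => f (g⁻¹ * t)) = m f

theorem isAmenable_iff {G : Type*} [Group G] :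
    IsAmenable G ↔ ∃ m : (G → ℝ) → ℝ, IsMean m ∧ ∀ g, IsInvUnder m g :=
  ⟨fun ⟨m, h1, h2, h3, h4, h5⟩ => ⟨m, ⟨h1, h2, h3, h4⟩, h5⟩,
    fun ⟨m, ⟨h1, h2, h3, h4⟩, h5⟩ => ⟨m, h1, h2, h3, h4, h5⟩⟩

namespace IsBddFun
variable {X Y : Type*} {f g : X → ℝ}

theorem const (c : ℝ) : IsBddFun (fun _ : X => c) := ⟨|c|, fun _ => le_rfl⟩

theorem add (hf : IsBddFun f) (hg : IsBddFun g) : IsBddFun (f + g) := by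
  obtain ⟨C, hC⟩ := hf
  obtain ⟨D, hD⟩ := hg
  exact ⟨C + D, fun x => (abs_add_le _ _).trans (add_le_add (hC x) (hD x))⟩

theorem smul (hf : IsBddFun f) (c : ℝ) : IsBddFun (c • f) := by
  obtain ⟨C, hC⟩ := hf
  refine ⟨|c| * C, fun x => ?_⟩
  rw [Pi.smul_apply, smul_eq_mul, abs_mul]
  exact mul_le_mul_of_nonneg_left (hC x) (abs_nonneg c)

theorem comp (hf : IsBddFun f) (q : Y → X) : IsBddFun (fun y => f (q y)) := by
  obtain ⟨C, hC⟩ := hf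
  exact ⟨C, fun y => hC _⟩

end IsBddFun

namespace IsMean
variable {X Y : Type*} {m : (X → ℝ) → ℝ}

theorem const (hm : IsMean m) (c : ℝ) : m (fun _ => c) = c := by
  have h := hm.smul c 1 (IsBddFun.const 1)
  rw [hm.one, mul_one] at h
  convert h using 2
  ext; simp

theorem mono (hm : IsMean m) {f g : X → ℝ} (hf : IsBddFun f) (hg : IsBddFun g)
    (h : ∀ x, f x ≤ g x) : m f ≤ m g := by
  have h1 := hm.nonneg (g + (-1 : ℝ) • f) (hg.add (hf.smul _)) (fun x => by simpa using h x)
  rw [hm.add _ _ hg (hf.smul _), hm.smul _ _ hf] at h1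
  linarith

theorem abs_le (hm : IsMean m) {f : X → ℝ} {C : ℝ} (h : ∀ x, |f x| ≤ C) : |m f| ≤ C := by
  have hf : IsBddFun f := ⟨C, h⟩
  rw [_root_.abs_le]
  constructor
  · rw [← hm.const (-C)]
    exact hm.mono (IsBddFun.const _) hf fun x => (_root_.abs_le.1 (h x)).1
  · rw [← hm.const C]
    exact hm.mono hf (IsBddFun.const _) fun x => (_root_.abs_le.1 (h x)).2

theorem isBddFun_apply {k : Y → (X → ℝ) → ℝ} (hk : ∀ y, IsMean (k y)) {f : X → ℝ}
    (hf : IsBddFun f) : IsBddFun (fun y => k y f) := by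
  obtain ⟨C, hC⟩ := hf
  exact ⟨C, fun y => (hk y).abs_le hC⟩

theorem dirac (x : X) : IsMean (fun f : X → ℝ => f x) :=
  ⟨fun _ _ _ _ => rfl, fun _ _ _ => rfl, fun _ _ h => h x, rfl⟩

/-- Averaging a family of means against a mean. -/
theorem bind (hm : IsMean m) {k : X → (Y → ℝ) → ℝ} (hk : ∀ x, IsMean (k x)) :
    IsMean (fun f => m fun x => k x f) where
  add f g hf hg := by
    rw [← hm.add _ _ (isBddFun_apply hk hf) (isBddFun_apply hk hg)]
    congr 1
    ext x
    exact (hk x).add f g hf hg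
  smul c f hf := by
    rw [← hm.smul _ _ (isBddFun_apply hk hf)]
    congr 1
    ext x
    exact (hk x).smul c f hf
  nonneg f hf h := hm.nonneg _ (isBddFun_apply hk hf) fun x => (hk x).nonneg f hf h
  one := by
    simp_rw [fun x => (hk x).one]
    exact hm.const 1

theorem map (hm : IsMean m) (q : X → Y) : IsMean (fun f : Y → ℝ => m fun x => f (q x)) :=
  hm.bind fun x => dirac (q x)

theorem tendsto_lim {ι : Type*} (U : Ultrafilter ι) {k : ι → (X → ℝ) → ℝ}
    (hk : ∀ i, IsMean (k i)) {f : X → ℝ} (hf : IsBddFun f) :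
    Tendsto (fun i => k i f) U (𝓝 (limUnder (U : Filter ι) fun i => k i f)) := by
  obtain ⟨C, hC⟩ := hf
  have hmem : ∀ i, k i f ∈ Set.Icc (-C) C := fun i => _root_.abs_le.1 ((hk i).abs_le hC)
  obtain ⟨x, -, hx⟩ := (isCompact_Icc (a := -C) (b := C)).ultrafilter_le_nhds'
    (U.map fun i => k i f) (Filter.mem_map.2 (Filter.univ_mem' hmem))
  exact tendsto_nhds_limUnder ⟨x, hx⟩

/-- The limit of a family of means along an ultrafilter. -/
theorem lim {ι : Type*} (U : Ultrafilter ι) {k : ι → (X → ℝ) → ℝ} (hk : ∀ i, IsMean (k i)) :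
    IsMean (fun f => limUnder (U : Filter ι) fun i => k i f) where
  add f g hf hg := by
    refine Tendsto.limUnder_eq ?_
    refine ((tendsto_lim U hk hf).add (tendsto_lim U hk hg)).congr fun i => ?_
    exact ((hk i).add f g hf hg).symm
  smul c f hf := by
    refine Tendsto.limUnder_eq ?_
    refine ((tendsto_lim U hk hf).const_mul c).congr fun i => ?_
    exact ((hk i).smul c f hf).symm
  nonneg f hf h := ge_of_tendsto' (tendsto_lim U hk hf) fun i => (hk i).nonneg f hf h
  one := Tendsto.limUnder_eq (tendsto_const_nhds.congr fun i => ((hk i).one).symm)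

end IsMean

theorem IsInvUnder.mul {G : Type*} [Group G] {m : (G → ℝ) → ℝ} {g h : G}
    (hg : IsInvUnder m g) (hh : IsInvUnder m h) : IsInvUnder m (g * h) := by
  intro f hf
  rw [← hh f hf, ← hg (fun t => f (h⁻¹ * t)) (hf.comp _)]
  simp [mul_assoc]

theorem IsInvUnder.inv {G : Type*} [Group G] {m : (G → ℝ) → ℝ} {g : G}
    (hg : IsInvUnder m g) : IsInvUnder m g⁻¹ := by
  intro f hf
  simpa using (hg _ (hf.comp fun t => g * t)).symm

theorem IsInvUnder.zpow {G : Type*} [Group G] {m : (G → ℝ) → ℝ} {g : G}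
    (hg : IsInvUnder m g) (z : ℤ) : IsInvUnder m (g ^ z) := by
  have hpow : ∀ n : ℕ, IsInvUnder m (g ^ n) := by
    intro n
    induction n with
    | zero => intro f _; simp
    | succ n ih => rw [pow_succ]; exact ih.mul hg
  obtain ⟨n, rfl | rfl⟩ := Int.eq_nat_or_neg z
  · rw [zpow_natCast]; exact hpow n
  · rw [zpow_neg, zpow_natCast]; exact (hpow n).inv

/-- Means that are asymptotically invariant along a nontrivial filter yield amenability. -/
theorem IsAmenable.of_tendsto {G ι : Type*} [Group G] {l : Filter ι} [l.NeBot]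
    {k : ι → (G → ℝ) → ℝ} (hk : ∀ i, IsMean (k i))
    (h : ∀ (g : G) (f : G → ℝ), IsBddFun f →
      Tendsto (fun i => k i (fun t => f (g⁻¹ * t)) - k i f) l (𝓝 0)) : IsAmenable G := by
  refine isAmenable_iff.2 ⟨_, IsMean.lim (Ultrafilter.of l) hk, fun g f hf => ?_⟩
  have h1 := (h g f hf).mono_left (Ultrafilter.of_le l)
  have h2 := h1.add (IsMean.tendsto_lim (Ultrafilter.of l) hk hf)
  simp only [sub_add_cancel, zero_add] at h2
  exact h2.limUnder_eq

theorem isAmenable_multiplicative_int : IsAmenable (Multiplicative ℤ) := by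
  have hk : ∀ n : ℕ, IsMean (fun f : Multiplicative ℤ → ℝ =>
      ((n : ℝ) + 1)⁻¹ * ∑ i ∈ Finset.range (n + 1), f (Multiplicative.ofAdd (i : ℤ))) := by
    intro n
    have hn : (0 : ℝ) < n + 1 := by positivity
    refine ⟨fun f g _ _ => ?_, fun c f _ => ?_, fun f _ h => ?_, ?_⟩
    · simp [Finset.sum_add_distrib, mul_add]
    · simp only [Pi.smul_apply, smul_eq_mul, ← Finset.mul_sum]
      ring
    · exact mul_nonneg (by positivity) (Finset.sum_nonneg fun i _ => h _)
    · simp [hn.ne']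
  let g : Multiplicative ℤ := Multiplicative.ofAdd 1
  have key : ∀ f : Multiplicative ℤ → ℝ, IsBddFun f → Tendsto (fun n : ℕ =>
      ((n : ℝ) + 1)⁻¹ * ∑ i ∈ Finset.range (n + 1), f (g⁻¹ * Multiplicative.ofAdd (i : ℤ)) -
      ((n : ℝ) + 1)⁻¹ * ∑ i ∈ Finset.range (n + 1), f (Multiplicative.ofAdd (i : ℤ)))
      atTop (𝓝 0) := by
    rintro f ⟨C, hC⟩
    refine squeeze_zero_norm (a := fun n : ℕ => (2 * C) * (1 / ((n : ℝ) + 1))) (fun n => ?_) ?_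
    · have hn : (0 : ℝ) < n + 1 := by positivity
      have hs : ∀ n : ℕ, ∑ i ∈ Finset.range (n + 1), f (g⁻¹ * Multiplicative.ofAdd (i : ℤ)) -
          ∑ i ∈ Finset.range (n + 1), f (Multiplicative.ofAdd (i : ℤ)) =
          f (Multiplicative.ofAdd (-1)) - f (Multiplicative.ofAdd (n : ℤ)) := by
        intro n
        induction n with
        | zero => simp [g]
        | succ n ih =>
          rw [Finset.sum_range_succ, Finset.sum_range_succ _ (n + 1)]
          have : g⁻¹ * Multiplicative.ofAdd ((n + 1 : ℕ) : ℤ) = Multiplicative.ofAdd (n : ℤ) := by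
            simp only [g, ← ofAdd_neg, ← ofAdd_add]
            congr 1
            push_cast
            ring
          rw [this]
          linarith
      rw [← mul_sub, hs n, Real.norm_eq_abs, abs_mul, abs_of_pos (inv_pos.2 hn), one_div,
        mul_comm (2 * C)]
      refine mul_le_mul_of_nonneg_left ?_ (by positivity)
      have h1 := abs_le.1 (hC (Multiplicative.ofAdd (-1)))
      have h2 := abs_le.1 (hC (Multiplicative.ofAdd (n : ℤ)))
      rw [abs_le]
      constructor <;> linarith
    · simpa using tendsto_one_div_add_atTop_nhds_zero_nat.const_mul (2 * C)
  have hm := IsMean.lim (hyperfilter ℕ) hk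
  refine isAmenable_iff.2 ⟨_, hm, fun h => ?_⟩
  have hh : h = g ^ h.toAdd := by
    simp [g, ← ofAdd_zsmul]
  rw [hh]
  refine IsInvUnder.zpow (fun f hf => ?_) _
  have h2 := ((key f hf).mono_left Nat.hyperfilter_le_atTop).add
    (IsMean.tendsto_lim (hyperfilter ℕ) hk hf)
  simp only [sub_add_cancel, zero_add] at h2
  exact h2.limUnder_eq

/-- The element of `A^{(G)}` supported at `g` with value `a`. -/
noncomputable def finSuppSingle {G A : Type*} [Group A] (g : G) (a : A) : finSupp G A := by
  classical
  exact ⟨Pi.mulSingle g a, (Set.finite_singleton g).subset fun t ht => by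
    by_contra h
    exact ht (Pi.mulSingle_eq_of_ne (M := fun _ : G => A) h a)⟩

theorem finSuppSingle_same {G A : Type*} [Group A] (g : G) (a : A) :
    (finSuppSingle g a : G → A) g = a := by
  classical
  exact Pi.mulSingle_eq_same (M := fun _ : G => A) g a

theorem finSuppSingle_of_ne {G A : Type*} [Group A] {g t : G} (h : t ≠ g) (a : A) :
    (finSuppSingle g a : G → A) t = 1 := by
  classical
  exact Pi.mulSingle_eq_of_ne (M := fun _ : G => A) h a

theorem exists_mean_finSupp {G A : Type*} [Group A] (hA : IsAmenable A) (F : Finset G) :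
    ∃ m : (finSupp G A → ℝ) → ℝ, IsMean m ∧
      ∀ w : finSupp G A, (∀ t ∉ F, (w : G → A) t = 1) → IsInvUnder m w := by
  classical
  obtain ⟨mA, hmA, hinvA⟩ := isAmenable_iff.1 hA
  induction F using Finset.induction_on with
  | empty =>
    refine ⟨_, IsMean.dirac 1, fun w hw f _ => ?_⟩
    have : w = 1 := Subtype.ext (funext fun t => hw t (Finset.notMem_empty t))
    simp [this]
  | insert g F hg ih =>
    obtain ⟨mF, hmF, hinvF⟩ := ih
    have hk : ∀ a : A, IsMean (fun f : finSupp G A → ℝ => mF fun v => f (finSuppSingle g a * v)) :=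
      fun a => hmF.map _
    refine ⟨_, hmA.bind hk, fun w hw => ?_⟩
    have hsingle : ∀ b : A, IsInvUnder
        (fun f => mA fun a => mF fun v => f (finSuppSingle g a * v)) (finSuppSingle g b) := by
      intro b f hf
      have h1 := hinvA b _ (IsMean.isBddFun_apply hk hf)
      simp only at h1 ⊢
      rw [← h1]
      congr! 4 with a v
      rw [← mul_assoc]
      congr 1
      refine Subtype.ext (funext fun t => ?_)
      by_cases ht : t = g
      · subst ht
        simp [finSuppSingle_same]
      · simp [finSuppSingle_of_ne ht]
    have hrest : ∀ u : finSupp G A, (∀ t ∉ F, (u : G → A) t = 1) → IsInvUnder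
        (fun f => mA fun a => mF fun v => f (finSuppSingle g a * v)) u := by
      intro u hu f hf
      refine congrArg mA (funext fun a => ?_)
      have h1 := hinvF u hu (fun v => f (finSuppSingle g a * v)) (hf.comp _)
      refine Eq.trans (congrArg mF (funext fun v => ?_)) h1
      refine congrArg f ?_
      rw [← mul_assoc, ← mul_assoc]
      congr 1
      refine Subtype.ext (funext fun t => ?_)
      by_cases ht : t = g
      · subst ht
        simp [hu t hg]
      · simp [finSuppSingle_of_ne ht]
    have hw' : w = finSuppSingle g ((w : G → A) g) *
        ((finSuppSingle g ((w : G → A) g))⁻¹ * w) := by group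
    rw [hw']
    refine (hsingle _).mul (hrest _ fun t ht => ?_)
    by_cases htg : t = g
    · subst htg
      simp [finSuppSingle_same]
    · have : t ∉ insert g F := by simp [htg, ht]
      simp [finSuppSingle_of_ne htg, hw t this]

theorem IsAmenable.finSupp {G A : Type*} [Group A] (hA : IsAmenable A) :
    IsAmenable (finSupp G A) := by
  classical
  choose m hm hinv using fun F : Finset G => exists_mean_finSupp hA F
  refine IsAmenable.of_tendsto (l := atTop) hm fun w f hf => ?_
  refine tendsto_const_nhds.congr' ?_
  filter_upwards [eventually_ge_atTop w.2.toFinset] with F hF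
  rw [hinv F w (fun t ht => ?_) f hf, sub_self]
  by_contra h
  exact ht (hF (w.2.mem_toFinset.2 h))

theorem IsAmenable.semidirectProduct {N G : Type*} [Group N] [Group G] {φ : G →* MulAut N}
    (hN : IsAmenable N) (hG : IsAmenable G) : IsAmenable (N ⋊[φ] G) := by
  obtain ⟨mN, hmN, hinvN⟩ := isAmenable_iff.1 hN
  obtain ⟨mG, hmG, hinvG⟩ := isAmenable_iff.1 hG
  have hk : ∀ g : G, IsMean (fun f : N ⋊[φ] G → ℝ => mN fun n =>
      f (SemidirectProduct.inr g * SemidirectProduct.inl n)) := fun g => hmN.map _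
  refine isAmenable_iff.2 ⟨_, hmG.bind hk, fun γ => ?_⟩
  rw [← SemidirectProduct.inl_left_mul_inr_right γ]
  refine IsInvUnder.mul (fun f hf => ?_) (fun f hf => ?_)
  · refine congrArg mG (funext fun g => ?_)
    have h1 := hinvN (φ g⁻¹ γ.left)
      (fun n => f (SemidirectProduct.inr g * SemidirectProduct.inl n)) (hf.comp _)
    refine Eq.trans (congrArg mN (funext fun n => congrArg f ?_)) h1
    rw [← mul_assoc, map_mul, ← mul_assoc]
    congr 1
    ext <;> simp
  · have h1 := hinvG γ.right _ (IsMean.isBddFun_apply hk hf)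
    simp only at h1 ⊢
    rw [← h1]
    congr! 4 with g n
    rw [map_mul, map_inv, mul_assoc]

theorem IsAmenable.wreath {A G : Type*} [Group A] [Group G] (hA : IsAmenable A)
    (hG : IsAmenable G) : IsAmenable (Wreath A G) :=
  hA.finSupp.semidirectProduct hG

/-- The complex-linear extension of a mean. -/
noncomputable def cmean {X : Type*} (m : (X → ℝ) → ℝ) (F : X → ℂ) : ℂ :=
  (m fun x => (F x).re : ℝ) + (m fun x => (F x).im : ℝ) * Complex.I

section
variable {X : Type*} {m : (X → ℝ) → ℝ}

theorem isBddFun_re {F : X → ℂ} {C : ℝ} (h : ∀ x, ‖F x‖ ≤ C) : IsBddFun fun x => (F x).re :=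
  ⟨C, fun x => (Complex.abs_re_le_norm _).trans (h x)⟩

theorem isBddFun_im {F : X → ℂ} {C : ℝ} (h : ∀ x, ‖F x‖ ≤ C) : IsBddFun fun x => (F x).im :=
  ⟨C, fun x => (Complex.abs_im_le_norm _).trans (h x)⟩

theorem IsMean.cmean_add (hm : IsMean m) {F F' : X → ℂ} {C C' : ℝ} (h : ∀ x, ‖F x‖ ≤ C)
    (h' : ∀ x, ‖F' x‖ ≤ C') : cmean m (fun x => F x + F' x) = cmean m F + cmean m F' := by
  have h1 := hm.add _ _ (isBddFun_re h) (isBddFun_re h')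
  have h2 := hm.add _ _ (isBddFun_im h) (isBddFun_im h')
  simp only [cmean, Complex.add_re, Complex.add_im]
  rw [show (fun x => (F x).re + (F' x).re) = (fun x => (F x).re) + fun x => (F' x).re from rfl,
    show (fun x => (F x).im + (F' x).im) = (fun x => (F x).im) + fun x => (F' x).im from rfl,
    h1, h2]
  push_cast
  ring

theorem IsMean.cmean_smul (hm : IsMean m) (c : ℂ) {F : X → ℂ} {C : ℝ} (h : ∀ x, ‖F x‖ ≤ C) :
    cmean m (fun x => c * F x) = c * cmean m F := by
  have hr := isBddFun_re h
  have hi := isBddFun_im h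
  have h1 : m (fun x => (c * F x).re) = c.re * (m fun x => (F x).re) +
      (-c.im) * (m fun x => (F x).im) := by
    rw [← hm.smul _ _ hr, ← hm.smul _ _ hi, ← hm.add _ _ (hr.smul _) (hi.smul _)]
    congr 1
    ext x
    simp [Complex.mul_re]
    ring
  have h2 : m (fun x => (c * F x).im) = c.re * (m fun x => (F x).im) +
      c.im * (m fun x => (F x).re) := by
    rw [← hm.smul _ _ hr, ← hm.smul _ _ hi, ← hm.add _ _ (hi.smul _) (hr.smul _)]
    congr 1
  simp only [cmean]
  rw [h1, h2]
  apply Complex.ext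
  · simp [sub_eq_add_neg]
  · simp

theorem IsMean.norm_cmean_le (hm : IsMean m) {F : X → ℂ} {C : ℝ} (h : ∀ x, ‖F x‖ ≤ C) :
    ‖cmean m F‖ ≤ 2 * C := by
  have h1 := hm.abs_le fun x => (Complex.abs_re_le_norm _).trans (h x)
  have h2 := hm.abs_le fun x => (Complex.abs_im_le_norm _).trans (h x)
  refine (norm_add_le _ _).trans ?_
  rw [norm_mul, Complex.norm_I, mul_one, Complex.norm_real, Complex.norm_real, two_mul]
  exact add_le_add h1 h2

theorem IsMean.cmean_conj (hm : IsMean m) {F : X → ℂ} {C : ℝ} (h : ∀ x, ‖F x‖ ≤ C) :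
    cmean m (fun x => (starRingEnd ℂ) (F x)) = (starRingEnd ℂ) (cmean m F) := by
  have h2 := hm.smul (-1) _ (isBddFun_im h)
  have h3 : (fun x => ((starRingEnd ℂ) (F x)).im) = (-1 : ℝ) • fun x => (F x).im := by
    ext; simp
  simp only [cmean]
  rw [h3, h2]
  simp

end

/-- A bounded group of operators preserving a positive invertible form is unitarizable. -/
theorem exists_unitarizer_of_form {Γ H : Type*} [Group Γ] [NormedAddCommGroup H]
    [InnerProductSpace ℂ H] [CompleteSpace H] (π : Γ →* (H →L[ℂ] H)ˣ) {Q : H →L[ℂ] H}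
    (hQ : 0 ≤ Q) (hu : IsUnit Q)
    (hinv : ∀ g, star (π g : H →L[ℂ] H) * Q * (π g : H →L[ℂ] H) = Q) :
    ∃ S : (H →L[ℂ] H)ˣ, ∀ g, ((S⁻¹ * π g * S : (H →L[ℂ] H)ˣ) : H →L[ℂ] H) ∈
      unitary (H →L[ℂ] H) := by
  have hRu : IsUnit (CFC.sqrt Q) := (CFC.isUnit_sqrt_iff Q hQ).2 hu
  obtain ⟨R, hR⟩ := hRu
  have hRR : (R : H →L[ℂ] H) * R = Q := by rw [hR]; exact CFC.sqrt_mul_sqrt_self Q hQ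
  have hRs : star (R : H →L[ℂ] H) = R := by
    rw [hR]
    exact (IsSelfAdjoint.of_nonneg (CFC.sqrt_nonneg Q)).star_eq
  have hRsu : star R = R := Units.ext hRs
  refine ⟨R⁻¹, fun g => ?_⟩
  set U : (H →L[ℂ] H)ˣ := R⁻¹⁻¹ * π g * R⁻¹ with hU
  have h1 : star (π g) * (R * R) * π g = R * R := by
    ext1
    push_cast
    rw [hRR]
    exact hinv g
  have h2 : star U * U = 1 := by
    rw [hU, star_mul, star_mul, star_inv, star_inv, star_inv, hRsu, inv_inv]
    calc R⁻¹ * (star (π g) * R) * (R * π g * R⁻¹)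
        = R⁻¹ * (star (π g) * (R * R) * π g) * R⁻¹ := by group
      _ = 1 := by rw [h1]; group
  have h3 : U * star U = 1 := by
    rw [eq_inv_of_mul_eq_one_left h2, mul_inv_cancel]
  rw [Unitary.mem_iff]
  exact ⟨by simpa using congrArg Units.val h2, by simpa using congrArg Units.val h3⟩

open InnerProductSpace in
/-- Day and Dixmier: amenable groups are unitarizable. -/
theorem IsAmenable.isUnitarizableGroup {Γ : Type*} [Group Γ] (hΓ : IsAmenable Γ) :
    IsUnitarizableGroup Γ := by
  intro H _ _ _ π ⟨C, hC⟩
  obtain ⟨m, hm, hinv⟩ := isAmenable_iff.1 hΓ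
  rcases subsingleton_or_nontrivial H with hH | hH
  · refine ⟨1, fun g => ?_⟩
    rw [Unitary.mem_iff]
    constructor <;> ext x <;> exact Subsingleton.elim _ _
  have hC1 : 1 ≤ C := by simpa using hC 1
  have hle : ∀ (t : Γ) (x : H), ‖(π t : H →L[ℂ] H) x‖ ≤ C * ‖x‖ := fun t x =>
    ((π t : H →L[ℂ] H).le_opNorm x).trans (mul_le_mul_of_nonneg_right (hC t) (norm_nonneg x))
  have hge : ∀ (t : Γ) (x : H), ‖x‖ ≤ C * ‖(π t : H →L[ℂ] H) x‖ := fun t x => by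
    refine le_trans (le_of_eq ?_) (hle t⁻¹ _)
    rw [← mul_apply_eq_comp, ← Units.val_mul, ← map_mul]
    simp
  let q : H → H → Γ → ℂ := fun x y t =>
    inner ℂ ((π t⁻¹ : H →L[ℂ] H) x) ((π t⁻¹ : H →L[ℂ] H) y)
  have hq : ∀ x y t, ‖q x y t‖ ≤ C * C * ‖x‖ * ‖y‖ := fun x y t => by
    refine (norm_inner_le_norm _ _).trans ?_
    refine (mul_le_mul (hle _ _) (hle _ _) (norm_nonneg _) (by positivity)).trans (le_of_eq ?_)
    ring
  let B : H →ₗ⋆[ℂ] H →ₗ[ℂ] ℂ := LinearMap.mk₂'ₛₗ (starRingEnd ℂ) (RingHom.id ℂ)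
    (fun x y => cmean m (q x y))
    (fun x x' y => by
      rw [← hm.cmean_add (hq x y) (hq x' y)]
      simp [q])
    (fun c x y => by
      rw [smul_eq_mul, ← hm.cmean_smul _ (hq x y)]
      simp only [q, map_smul, inner_smul_left])
    (fun x y y' => by
      rw [← hm.cmean_add (hq x y) (hq x y')]
      simp [q])
    (fun c x y => by
      rw [smul_eq_mul, RingHom.id_apply, ← hm.cmean_smul _ (hq x y)]
      simp only [q, map_smul, inner_smul_right])
  let Bc : H →L⋆[ℂ] H →L[ℂ] ℂ := B.mkContinuous₂ (2 * (C * C)) fun x y => by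
    refine (hm.norm_cmean_le (hq x y)).trans (le_of_eq ?_)
    ring
  let Q : H →L[ℂ] H := continuousLinearMapOfBilin Bc
  have hQ : ∀ x y, inner ℂ (Q x) y = cmean m (q x y) := fun x y =>
    continuousLinearMapOfBilin_apply Bc x y
  have hqq : ∀ x t, q x x t = ((‖(π t⁻¹ : H →L[ℂ] H) x‖ ^ 2 : ℝ) : ℂ) := fun x t => by
    simp only [q]
    rw [inner_self_eq_norm_sq_to_K]
    simp
  have hpos : ∀ x, (C * C)⁻¹ * ‖x‖ ^ 2 ≤ (inner ℂ (Q x) x).re := fun x => by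
    have h1 : (inner ℂ (Q x) x).re = m fun t => ‖(π t⁻¹ : H →L[ℂ] H) x‖ ^ 2 := by
      rw [hQ, cmean]
      simp only [hqq]
      simp [-Complex.ofReal_pow]
    rw [h1, ← hm.const ((C * C)⁻¹ * ‖x‖ ^ 2)]
    refine hm.mono (IsBddFun.const _) ⟨(C * ‖x‖) ^ 2, fun t => ?_⟩ fun t => ?_
    · rw [abs_of_nonneg (by positivity)]
      exact pow_le_pow_left₀ (norm_nonneg _) (hle _ _) 2
    · rw [inv_mul_le_iff₀ (by positivity)]
      calc ‖x‖ ^ 2 ≤ (C * ‖(π t⁻¹ : H →L[ℂ] H) x‖) ^ 2 :=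
            pow_le_pow_left₀ (norm_nonneg _) (hge _ _) 2
        _ = _ := by ring
  have hCC : 0 < (C * C)⁻¹ := by positivity
  refine exists_unitarizer_of_form π (Q := Q) ?_ ?_ fun g => ?_
  · rw [ContinuousLinearMap.nonneg_iff_isPositive]
    refine ⟨fun x y => ?_, fun x => ?_⟩
    · change inner ℂ (Q x) y = inner ℂ x (Q y)
      rw [← inner_conj_symm x (Q y), hQ, hQ, ← hm.cmean_conj (hq y x)]
      simp [q]
    · exact le_trans (by positivity) (hpos x)
  · refine ContinuousLinearMap.isUnit_of_forall_le_norm_inner_map Q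
      (c := ⟨(C * C)⁻¹, hCC.le⟩) hCC fun x => ?_
    rw [mul_comm]
    exact (hpos x).trans (Complex.re_le_norm _)
  · ext x
    refine ext_inner_right ℂ fun y => ?_
    rw [mul_apply_eq_comp, mul_apply_eq_comp,
      ContinuousLinearMap.star_eq_adjoint, ContinuousLinearMap.adjoint_inner_left, hQ, hQ]
    have h1 := hinv g _ (isBddFun_re (hq x y))
    have h2 := hinv g _ (isBddFun_im (hq x y))
    rw [cmean, cmean, ← h1, ← h2]
    have : ∀ t, q ((π g : H →L[ℂ] H) x) ((π g : H →L[ℂ] H) y) t = q x y (g⁻¹ * t) := fun t => by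
      simp only [q]
      rw [← mul_apply_eq_comp, ← mul_apply_eq_comp, ← Units.val_mul,
        ← map_mul, mul_inv_rev, inv_inv]
    simp only [this]

section WeightedComp
open MeasureTheory

variable {Ω : Type*} [MeasurableSpace Ω] {μ : Measure Ω}

theorem memLp_weightedComp {φ : Ω → ℂ} (hφ : Measurable φ) (hb : ∃ C, ∀ x, ‖φ x‖ ≤ C) {q : Ω → Ω}
    (hq : MeasurePreserving q μ μ) (f : Lp ℂ 2 μ) : MemLp (fun x => φ x * f (q x)) 2 μ := by
  obtain ⟨C, hC⟩ := hb
  have h := (Lp.memLp f).comp_measurePreserving hq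
  refine h.of_le_mul (c := C) (hφ.aestronglyMeasurable.mul h.1) (ae_of_all _ fun x => ?_)
  rw [norm_mul]
  exact mul_le_mul_of_nonneg_right (hC x) (norm_nonneg _)

/-- A bounded measurable weight together with a measure preserving self-map. -/
structure WeightedMap (μ : Measure Ω) where
  /-- the weight -/
  φ : Ω → ℂ
  /-- the map -/
  q : Ω → Ω
  measurable_weight : Measurable φ
  bdd : ∃ C, ∀ x, ‖φ x‖ ≤ C
  mp : MeasurePreserving q μ μ

namespace WeightedMap

/-- The underlying function of the weighted composition operator. -/
noncomputable def toFun (w : WeightedMap μ) (f : Lp ℂ 2 μ) : Lp ℂ 2 μ :=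
  (memLp_weightedComp w.measurable_weight w.bdd w.mp f).toLp

theorem coeFn_toFun (w : WeightedMap μ) (f : Lp ℂ 2 μ) :
    w.toFun f =ᵐ[μ] fun x => w.φ x * f (w.q x) := MemLp.coeFn_toLp _

theorem norm_toFun_le (w : WeightedMap μ) {C : ℝ} (hC : ∀ x, ‖w.φ x‖ ≤ C) (f : Lp ℂ 2 μ) :
    ‖w.toFun f‖ ≤ C * ‖f‖ := by
  rw [← Lp.norm_compMeasurePreserving f w.mp]
  refine Lp.norm_le_mul_norm_of_ae_le_mul ?_
  filter_upwards [w.coeFn_toFun f, Lp.coeFn_compMeasurePreserving f w.mp] with x h1 h2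
  rw [h1, h2, norm_mul]
  exact mul_le_mul_of_nonneg_right (hC x) (norm_nonneg _)

/-- The weighted composition operator `f ↦ φ • (f ∘ q)` on `L²`. -/
noncomputable def op (w : WeightedMap μ) : Lp ℂ 2 μ →L[ℂ] Lp ℂ 2 μ :=
  LinearMap.mkContinuousOfExistsBound
    { toFun := w.toFun
      map_add' := fun f g => by
        refine Lp.ext ?_
        filter_upwards [w.coeFn_toFun f, w.coeFn_toFun g, w.coeFn_toFun (f + g),
          Lp.coeFn_add (w.toFun f) (w.toFun g),
          w.mp.quasiMeasurePreserving.ae (Lp.coeFn_add f g)] with x h1 h2 h3 h4 h5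
        rw [h3, h4, Pi.add_apply, h1, h2, h5, Pi.add_apply, mul_add]
      map_smul' := fun c f => by
        refine Lp.ext ?_
        filter_upwards [w.coeFn_toFun f, w.coeFn_toFun (c • f),
          Lp.coeFn_smul c (w.toFun f),
          w.mp.quasiMeasurePreserving.ae (Lp.coeFn_smul c f)] with x h1 h3 h4 h5
        rw [h3, RingHom.id_apply, h4, Pi.smul_apply, h1, h5, Pi.smul_apply, smul_eq_mul,
          smul_eq_mul, mul_left_comm] }
    (w.bdd.imp fun _ hC => w.norm_toFun_le hC)

theorem coeFn_op (w : WeightedMap μ) (f : Lp ℂ 2 μ) :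
    w.op f =ᵐ[μ] fun x => w.φ x * f (w.q x) := w.coeFn_toFun f

theorem norm_op_apply_le (w : WeightedMap μ) {C : ℝ} (hC : ∀ x, ‖w.φ x‖ ≤ C) (f : Lp ℂ 2 μ) :
    ‖w.op f‖ ≤ C * ‖f‖ := w.norm_toFun_le hC f

theorem norm_op_le (w : WeightedMap μ) {C : ℝ} (h0 : 0 ≤ C) (hC : ∀ x, ‖w.φ x‖ ≤ C) :
    ‖w.op‖ ≤ C := ContinuousLinearMap.opNorm_le_bound _ h0 (w.norm_op_apply_le hC)

theorem op_congr {w w' : WeightedMap μ} (hφ : ∀ x, w.φ x = w'.φ x)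
    (hq : ∀ x, w.q x = w'.q x) : w.op = w'.op := by
  congr 1
  obtain ⟨φ, q, _, _, _⟩ := w
  obtain ⟨φ', q', _, _, _⟩ := w'
  obtain rfl : φ = φ' := funext hφ
  obtain rfl : q = q' := funext hq
  rfl

/-- The weighted map corresponding to the product of operators. -/
def comp (w w' : WeightedMap μ) : WeightedMap μ where
  φ x := w.φ x * w'.φ (w.q x)
  q x := w'.q (w.q x)
  measurable_weight := w.measurable_weight.mul (w'.measurable_weight.comp w.mp.measurable)
  bdd := by
    obtain ⟨C, hC⟩ := w.bdd
    obtain ⟨C', hC'⟩ := w'.bdd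
    refine ⟨C * C', fun x => ?_⟩
    rw [norm_mul]
    exact mul_le_mul (hC x) (hC' _) (norm_nonneg _) ((norm_nonneg _).trans (hC x))
  mp := w'.mp.comp w.mp

theorem op_mul (w w' : WeightedMap μ) : w.op * w'.op = (w.comp w').op := by
  ext1 f
  refine Lp.ext ?_
  filter_upwards [w.coeFn_op (w'.op f), w.mp.quasiMeasurePreserving.ae (w'.coeFn_op f),
    (w.comp w').coeFn_op f] with x h1 h2 h3
  rw [mul_apply_eq_comp, h1, h2, h3]
  simp [comp, mul_assoc]

/-- Composition with a measure preserving map. -/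
def ofMap {q : Ω → Ω} (hq : MeasurePreserving q μ μ) : WeightedMap μ where
  φ _ := 1
  q := q
  measurable_weight := measurable_const
  bdd := ⟨1, by simp⟩
  mp := hq

/-- Multiplication by a bounded measurable function. -/
def ofWeight {φ : Ω → ℂ} (hφ : Measurable φ) (hb : ∃ C, ∀ x, ‖φ x‖ ≤ C) : WeightedMap μ where
  φ := φ
  q := id
  measurable_weight := hφ
  bdd := hb
  mp := MeasurePreserving.id μ

theorem op_eq_one {w : WeightedMap μ} (hφ : ∀ x, w.φ x = 1) (hq : ∀ x, w.q x = x) :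
    w.op = 1 := by
  ext1 f
  refine Lp.ext ?_
  filter_upwards [w.coeFn_op f] with x h1
  rw [h1, hφ, hq, one_mul]
  rfl

end WeightedMap

end WeightedComp

section LeftRegular
open MeasureTheory

theorem measurePreserving_count_equiv {α : Type*} [MeasurableSpace α] [DiscreteMeasurableSpace α]
    (e : α ≃ α) : MeasurePreserving e (Measure.count : Measure α) Measure.count := by
  refine ⟨Measurable.of_discrete, Measure.ext fun s hs => ?_⟩
  rw [Measure.map_apply Measurable.of_discrete hs, Measure.count_apply .of_discrete,
    Measure.count_apply hs, ← Equiv.image_symm_eq_preimage, (Equiv.injective _).encard_image]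

theorem integral_norm_sq_eq {Ω : Type*} [MeasurableSpace Ω] {μ : Measure Ω} (ξ : Lp ℂ 2 μ) :
    ∫ t, ‖ξ t‖ ^ 2 ∂μ = ‖ξ‖ ^ 2 := by
  have h : inner ℂ ξ ξ = ((‖ξ‖ ^ 2 : ℝ) : ℂ) := by
    rw [inner_self_eq_norm_sq_to_K]
    simp
  rw [L2.inner_def] at h
  have h2 : ∀ t, inner ℂ (ξ t) (ξ t) = ((‖ξ t‖ ^ 2 : ℝ) : ℂ) := fun t => by
    rw [inner_self_eq_norm_sq_to_K]
    simp
  simp only [h2] at h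
  rw [integral_complex_ofReal] at h
  exact_mod_cast h

variable {G : Type} [MeasurableSpace G] [DiscreteMeasurableSpace G]

theorem integrable_mul_norm_sq (ξ : Lp ℂ 2 (Measure.count : Measure G)) {f : G → ℝ}
    (hf : IsBddFun f) : Integrable (fun t => f t * ‖ξ t‖ ^ 2) (Measure.count : Measure G) := by
  obtain ⟨C, hC⟩ := hf
  exact ((memLp_two_iff_integrable_sq_norm (Lp.memLp ξ).1).1 (Lp.memLp ξ)).bdd_mul (c := C)
    (Measurable.of_discrete.aestronglyMeasurable) (ae_of_all _ hC)

theorem isMean_integral {ξ : Lp ℂ 2 (Measure.count : Measure G)} (hξ : ‖ξ‖ = 1) :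
    IsMean fun f : G → ℝ => ∫ t, f t * ‖ξ t‖ ^ 2 ∂Measure.count where
  add f g hf hg := by
    rw [← integral_add (integrable_mul_norm_sq ξ hf) (integrable_mul_norm_sq ξ hg)]
    simp only [Pi.add_apply, add_mul]
  smul c f _ := by
    rw [← integral_const_mul]
    simp only [Pi.smul_apply, smul_eq_mul, mul_assoc]
  nonneg f _ h0 := integral_nonneg fun t => mul_nonneg (h0 t) (sq_nonneg _)
  one := by simp [integral_norm_sq_eq, hξ]

theorem abs_integral_sub_le (ξ η : Lp ℂ 2 (Measure.count : Measure G)) (hξ : ‖ξ‖ ≤ 1)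
    (hη : ‖η‖ ≤ 1) {f : G → ℝ} {C : ℝ} (hC : ∀ t, |f t| ≤ C) (hC0 : 0 ≤ C) :
    |∫ t, f t * ‖ξ t‖ ^ 2 ∂Measure.count - ∫ t, f t * ‖η t‖ ^ 2 ∂Measure.count| ≤
      2 * C * ‖ξ - η‖ := by
  have hCc : ∀ t, ‖(f t : ℂ)‖ ≤ C := fun t => by rw [Complex.norm_real]; exact hC t
  let W : WeightedMap (Measure.count : Measure G) :=
    WeightedMap.ofWeight (φ := fun t => (f t : ℂ)) Measurable.of_discrete ⟨C, hCc⟩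
  have hW : ∀ ζ : Lp ℂ 2 (Measure.count : Measure G),
      inner ℂ ζ (W.op ζ) = ((∫ t, f t * ‖ζ t‖ ^ 2 ∂Measure.count : ℝ) : ℂ) := fun ζ => by
    rw [L2.inner_def, ← integral_complex_ofReal]
    refine integral_congr_ae ?_
    filter_upwards [W.coeFn_op ζ] with t ht
    rw [ht]
    simp only [W, WeightedMap.ofWeight, id]
    rw [← smul_eq_mul, inner_smul_right, inner_self_eq_norm_sq_to_K]
    simp
  have hn : ∀ ζ, ‖W.op ζ‖ ≤ C * ‖ζ‖ := W.norm_op_apply_le hCc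
  have h1 : ((∫ t, f t * ‖ξ t‖ ^ 2 ∂Measure.count : ℝ) : ℂ) -
      ((∫ t, f t * ‖η t‖ ^ 2 ∂Measure.count : ℝ) : ℂ) =
      inner ℂ (ξ - η) (W.op ξ) + inner ℂ η (W.op (ξ - η)) := by
    rw [← hW, ← hW, map_sub, inner_sub_left, inner_sub_right]
    ring
  rw [← Real.norm_eq_abs, ← Complex.norm_real, Complex.ofReal_sub, h1]
  have h2 : ‖inner ℂ (ξ - η) (W.op ξ)‖ ≤ ‖ξ - η‖ * (C * 1) :=
    (norm_inner_le_norm _ _).trans (mul_le_mul_of_nonneg_left ((hn ξ).trans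
      (mul_le_mul_of_nonneg_left hξ hC0)) (norm_nonneg _))
  have h3 : ‖inner ℂ η (W.op (ξ - η))‖ ≤ 1 * (C * ‖ξ - η‖) :=
    (norm_inner_le_norm _ _).trans (mul_le_mul hη (hn _) (norm_nonneg _) zero_le_one)
  refine (norm_add_le _ _).trans ?_
  linarith

variable [Group G]

/-- The left regular representation. -/
noncomputable def leftReg (g : G) :
    Lp ℂ 2 (Measure.count : Measure G) →L[ℂ] Lp ℂ 2 (Measure.count : Measure G) :=
  (WeightedMap.ofMap (measurePreserving_count_equiv (Equiv.mulLeft g⁻¹))).op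

theorem leftReg_apply (g : G) (f : Lp ℂ 2 (Measure.count : Measure G)) (t : G) :
    leftReg g f t = f (g⁻¹ * t) := by
  have h := (WeightedMap.ofMap (measurePreserving_count_equiv (Equiv.mulLeft g⁻¹))).coeFn_op f
  have h2 := Measure.ae_count_iff.1 h t
  exact h2.trans (one_mul _)

theorem norm_leftReg_apply_le (g : G) (f : Lp ℂ 2 (Measure.count : Measure G)) :
    ‖leftReg g f‖ ≤ ‖f‖ := by
  exact (WeightedMap.norm_op_apply_le _ (C := 1) (by simp [WeightedMap.ofMap]) f).trans
    (one_mul _).le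

theorem leftReg_mul (g h : G) : leftReg (g * h) = leftReg g * leftReg h := by
  rw [leftReg, leftReg, leftReg, WeightedMap.op_mul]
  refine WeightedMap.op_congr (fun x => ?_) fun x => ?_
  · simp [WeightedMap.ofMap, WeightedMap.comp]
  · simp [WeightedMap.ofMap, WeightedMap.comp, mul_assoc]

theorem leftReg_one : leftReg (1 : G) = 1 :=
  WeightedMap.op_eq_one (fun _ => rfl) (by simp [WeightedMap.ofMap])

theorem exists_sum_leftReg_pow {ι : Type} [Fintype ι] [Nonempty ι] (σ : ι → G) (k : ℕ) :
    ∃ (κ : Type) (_ : Fintype κ) (_ : Nonempty κ) (τ : κ → G),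
      Fintype.card κ = Fintype.card ι ^ k ∧ ∑ j, leftReg (τ j) = (∑ i, leftReg (σ i)) ^ k := by
  induction k with
  | zero => exact ⟨Unit, inferInstance, inferInstance, fun _ => 1, by simp, by simp [leftReg_one]⟩
  | succ k ih =>
    obtain ⟨κ, _, _, τ, h1, h2⟩ := ih
    refine ⟨κ × ι, inferInstance, inferInstance, fun p => τ p.1 * σ p.2, ?_, ?_⟩
    · rw [Fintype.card_prod, h1, pow_succ]
    · rw [pow_succ, ← h2, Fintype.sum_prod_type, Finset.sum_mul_sum]
      simp only [leftReg_mul]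

/-- Almost invariant unit vectors obtained from averages of norm one. -/
theorem exists_almost_invariant
    (h : ∀ (ι : Type) [Fintype ι] [Nonempty ι] (σ : ι → G),
      (Fintype.card ι : ℝ) ≤ ‖∑ i, leftReg (σ i)‖) (F : Finset G) {δ : ℝ} (hδ : 0 < δ)
      (hδ1 : δ ≤ 1) :
    ∃ ξ : Lp ℂ 2 (Measure.count : Measure G), ‖ξ‖ = 1 ∧
      ∀ s ∈ F, ‖leftReg s ξ - ξ‖ ^ 2 ≤ 4 * δ := by
  classical
  set S := ∑ i : Option F, leftReg (i.elim (1 : G) fun s => (s : G)) with hS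
  have h1 := h (Option F) fun i => i.elim (1 : G) fun s => (s : G)
  rw [← hS, Fintype.card_option, Fintype.card_coe] at h1
  push_cast at h1
  obtain ⟨x, hx1, hx⟩ := S.exists_lt_apply_of_lt_opNorm (r := F.card + 1 - δ) (by linarith)
  have hx0 : 0 < ‖x‖ := by
    rw [norm_pos_iff]
    rintro rfl
    rw [map_zero, norm_zero] at hx
    have : (0 : ℝ) ≤ F.card := Nat.cast_nonneg _
    linarith
  set ξ := ((‖x‖⁻¹ : ℝ) : ℂ) • x with hξ
  have hξ1 : ‖ξ‖ = 1 := by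
    rw [hξ, norm_smul, Complex.norm_real, norm_inv, norm_norm, inv_mul_cancel₀ hx0.ne']
  have hSξ : F.card + 1 - δ < ‖S ξ‖ := by
    refine hx.trans_le ?_
    rw [hξ, map_smul, norm_smul, Complex.norm_real, norm_inv, norm_norm]
    exact le_mul_of_one_le_left (norm_nonneg _) ((one_le_inv₀ hx0).2 hx1.le)
  refine ⟨ξ, hξ1, fun s hs => ?_⟩
  have hSs : S ξ = (leftReg s ξ + ξ) + ∑ t ∈ F.erase s, leftReg t ξ := by
    rw [hS, Fintype.sum_option]
    simp only [Option.elim, leftReg_one]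
    rw [add_apply, one_apply_eq_self, _root_.sum_apply,
      Finset.sum_coe_sort F fun t => leftReg t ξ, ← Finset.add_sum_erase F _ hs]
    abel
  have hle : ‖S ξ‖ ≤ ‖leftReg s ξ + ξ‖ + ((F.card : ℝ) - 1) := by
    rw [hSs]
    refine (norm_add_le _ _).trans (add_le_add le_rfl ?_)
    refine (norm_sum_le_of_le (F.erase s) (f := fun t => leftReg t ξ) (n := fun _ => 1)
      fun t _ => (norm_leftReg_apply_le t ξ).trans hξ1.le).trans ?_
    rw [Finset.sum_const, Finset.card_erase_of_mem hs, nsmul_eq_mul, mul_one,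
      Nat.cast_pred (Finset.card_pos.2 ⟨s, hs⟩)]
  have hp := parallelogram_law_with_norm ℂ (leftReg s ξ) ξ
  have h2 := (norm_leftReg_apply_le s ξ).trans hξ1.le
  have h3 : 2 - δ ≤ ‖leftReg s ξ + ξ‖ := by linarith
  have h4 : (2 - δ) ^ 2 ≤ ‖leftReg s ξ + ξ‖ ^ 2 := pow_le_pow_left₀ (by linarith) h3 2
  have h5 : ‖leftReg s ξ‖ ^ 2 ≤ 1 := pow_le_one₀ (norm_nonneg _) h2
  rw [hξ1] at hp
  nlinarith [sq_nonneg δ]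

/-- Kesten and Day: in a nonamenable group some average of translations has small norm. -/
theorem exists_norm_sum_leftReg_le (hG : ¬ IsAmenable G) {ε : ℝ} (hε : 0 < ε) :
    ∃ (ι : Type) (_ : Fintype ι) (_ : Nonempty ι) (σ : ι → G),
      ‖∑ i, leftReg (σ i)‖ ≤ ε * Fintype.card ι := by
  classical
  by_contra! hcon
  apply hG
  have hbig : ∀ (ι : Type) [Fintype ι] [Nonempty ι] (σ : ι → G),
      (Fintype.card ι : ℝ) ≤ ‖∑ i, leftReg (σ i)‖ := by
    intro ι _ _ σ
    by_contra! hlt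
    have hpos : (0 : ℝ) < Fintype.card ι := Nat.cast_pos.2 Fintype.card_pos
    obtain ⟨k, hk⟩ := exists_pow_lt_of_lt_one hε ((div_lt_one hpos).2 hlt)
    obtain ⟨κ, _, _, τ, h1, h2⟩ := exists_sum_leftReg_pow σ k
    have h3 := hcon κ inferInstance inferInstance τ
    rw [h1, h2] at h3
    push_cast at h3
    rw [div_pow, div_lt_iff₀ (by positivity)] at hk
    have h4 : ‖(∑ i, leftReg (σ i)) ^ k‖ ≤ ‖∑ i, leftReg (σ i)‖ ^ k := by
      rcases Nat.eq_zero_or_pos k with rfl | hk0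
      · exact ContinuousLinearMap.norm_id_le.trans (pow_zero _).ge
      · exact norm_pow_le' _ hk0
    linarith
  choose ξ hξ1 hξ2 using fun p : Finset G × ℕ =>
    exists_almost_invariant hbig p.1 (δ := 1 / ((p.2 : ℝ) + 1)) (by positivity)
      (by rw [div_le_one (by positivity)]; linarith [Nat.cast_nonneg (α := ℝ) p.2])
  refine IsAmenable.of_tendsto (l := (atTop : Filter (Finset G × ℕ)))
    (fun p => isMean_integral (hξ1 p)) fun g f ⟨C, hC⟩ => ?_
  have hC0 : 0 ≤ C := (abs_nonneg _).trans (hC 1)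
  have hlim : Tendsto (fun p : Finset G × ℕ =>
      2 * C * Real.sqrt (4 * (1 / ((p.2 : ℝ) + 1)))) atTop (𝓝 0) := by
    have h1 : Tendsto (fun p : Finset G × ℕ => p.2) atTop atTop := by
      rw [← prod_atTop_atTop_eq]
      exact tendsto_snd
    have h2 := (tendsto_one_div_add_atTop_nhds_zero_nat (𝕜 := ℝ)).comp h1
    have h3 := ((h2.const_mul 4).sqrt).const_mul (2 * C)
    simpa using h3
  refine squeeze_zero_norm' ?_ hlim
  filter_upwards [eventually_ge_atTop (({g⁻¹} : Finset G), 0)] with p hp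
  have hmem : g⁻¹ ∈ p.1 := hp.1 (Finset.mem_singleton_self _)
  have hshift : ∫ t, f (g⁻¹ * t) * ‖ξ p t‖ ^ 2 ∂Measure.count =
      ∫ t, f t * ‖leftReg g⁻¹ (ξ p) t‖ ^ 2 ∂Measure.count := by
    simp only [leftReg_apply, inv_inv]
    let e : G ≃ᵐ G := ⟨Equiv.mulLeft g, .of_discrete, .of_discrete⟩
    rw [← (measurePreserving_count_equiv (Equiv.mulLeft g)).integral_comp e.measurableEmbedding]
    simp
  rw [hshift, Real.norm_eq_abs]
  refine (abs_integral_sub_le _ _ ((norm_leftReg_apply_le _ _).trans (hξ1 p).le) (hξ1 p).le hC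
    hC0).trans (mul_le_mul_of_nonneg_left ?_ (by positivity))
  exact Real.le_sqrt_of_sq_le (hξ2 p _ hmem)

end LeftRegular

section ClosedWords
open MeasureTheory

variable {G : Type} [Group G] [MeasurableSpace G] [DiscreteMeasurableSpace G]

theorem inner_leftReg_inv (g : G) (f h : Lp ℂ 2 (Measure.count : Measure G)) :
    inner ℂ (leftReg g⁻¹ f) h = inner ℂ f (leftReg g h) := by
  rw [L2.inner_def, L2.inner_def]
  simp only [leftReg_apply, inv_inv]
  let e : G ≃ᵐ G := ⟨Equiv.mulLeft g⁻¹, .of_discrete, .of_discrete⟩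
  rw [← (measurePreserving_count_equiv (Equiv.mulLeft g⁻¹)).integral_comp e.measurableEmbedding]
  simp

theorem norm_sum_leftReg_inv {ι : Type} [Fintype ι] (σ : ι → G) :
    ‖∑ i, leftReg (σ i)⁻¹‖ = ‖∑ i, leftReg (σ i)‖ := by
  rw [← ContinuousLinearMap.adjoint.norm_map (∑ i, leftReg (σ i))]
  congr 1
  rw [ContinuousLinearMap.eq_adjoint_iff]
  intro f h
  simp only [_root_.sum_apply, sum_inner, inner_sum, inner_leftReg_inv]

theorem pow_sum_leftReg {κ : Type} [Fintype κ] (τ : κ → G) (m : ℕ) :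
    (∑ k, leftReg (τ k)) ^ m =
      ∑ w : Fin m → κ, leftReg (List.ofFn fun k => τ (w k)).prod := by
  induction m with
  | zero => simp [leftReg_one]
  | succ m ih =>
    rw [pow_succ', ih, Finset.sum_mul_sum, ← Fintype.sum_prod_type']
    refine Fintype.sum_equiv (Fin.consEquiv fun _ => κ) _ _ fun p => ?_
    simp [List.ofFn_succ, leftReg_mul]

theorem inner_single_leftReg [DecidableEq G] (g : G) :
    inner ℂ (indicatorConstLp 2 (μ := (Measure.count : Measure G)) (s := {1}) .of_discrete
      (by simp) (1 : ℂ)) (leftReg g (indicatorConstLp 2 (μ := (Measure.count : Measure G))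
        (s := {1}) .of_discrete (by simp) (1 : ℂ))) = if g = 1 then 1 else 0 := by
  have h_int : ∀ F : G → ℂ, ∫ x in {1}, F x ∂Measure.count = F 1 := fun F => by
    rw [Measure.restrict_singleton, Measure.count_singleton, one_smul, integral_dirac]
  rw [L2.inner_indicatorConstLp_one, h_int, leftReg_apply]
  have h := Measure.ae_count_iff.1 (indicatorConstLp_coeFn (p := 2)
    (μ := (Measure.count : Measure G)) (s := {1}) (hs := .of_discrete)
      (hμs := by simp) (c := (1 : ℂ))) (g⁻¹ * 1)
  rw [h]
  simp [Set.indicator_apply]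

/-- The number of closed words is bounded by powers of the norm of the sum of translations. -/
theorem card_closed_words_le {κ : Type} [Fintype κ] (τ : κ → G) {c : ℝ}
    (hc : ‖∑ k, leftReg (τ k)‖ ≤ c) (m : ℕ) :
    (Nat.card {w : Fin m → κ // (List.ofFn fun k => τ (w k)).prod = 1} : ℝ) ≤ c ^ m := by
  classical
  set δ := indicatorConstLp 2 (μ := (Measure.count : Measure G)) (s := {1}) .of_discrete
    (by simp) (1 : ℂ) with hδ
  have hδ1 : ‖δ‖ = 1 := by
    rw [hδ, norm_indicatorConstLp (by norm_num) (by norm_num)]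
    simp
  have h1 : inner ℂ δ (((∑ k, leftReg (τ k)) ^ m) δ) =
      (Nat.card {w : Fin m → κ // (List.ofFn fun k => τ (w k)).prod = 1} : ℂ) := by
    rw [pow_sum_leftReg, _root_.sum_apply, inner_sum]
    simp only [hδ, inner_single_leftReg]
    rw [Finset.sum_boole, Nat.card_eq_fintype_card, Fintype.card_subtype]
  have hpow : ∀ n : ℕ, ‖((∑ k, leftReg (τ k)) ^ n) δ‖ ≤ c ^ n := fun n => by
    induction n with
    | zero => simp [hδ1]
    | succ n ih =>
      rw [pow_succ', pow_succ', mul_apply_eq_comp]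
      exact (ContinuousLinearMap.le_opNorm _ _).trans
        (mul_le_mul hc ih (norm_nonneg _) ((norm_nonneg _).trans hc))
  have h3 := (norm_inner_le_norm (𝕜 := ℂ) δ (((∑ k, leftReg (τ k)) ^ m) δ)).trans
    (mul_le_mul hδ1.le (hpow m) (norm_nonneg _) zero_le_one)
  rw [h1, one_mul, Complex.norm_natCast] at h3
  exact h3

end ClosedWords

section Derivation

variable {Γ K : Type} [Group Γ] [NormedAddCommGroup K] [InnerProductSpace ℂ K]

/-- The block upper triangular operator `(x, y) ↦ (a x + b y, a y)`. -/
noncomputable def triangular (a b : K →L[ℂ] K) : WithLp 2 (K × K) →L[ℂ] WithLp 2 (K × K) :=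
  (WithLp.prodContinuousLinearEquiv 2 ℂ K K).symm.toContinuousLinearMap ∘L
    (((a ∘L ContinuousLinearMap.fst ℂ K K + b ∘L ContinuousLinearMap.snd ℂ K K).prod
      (a ∘L ContinuousLinearMap.snd ℂ K K)) ∘L
      (WithLp.prodContinuousLinearEquiv 2 ℂ K K).toContinuousLinearMap)

@[simp]
theorem triangular_fst (a b : K →L[ℂ] K) (w : WithLp 2 (K × K)) :
    (triangular a b w).fst = a w.fst + b w.snd := rfl

@[simp]
theorem triangular_snd (a b : K →L[ℂ] K) (w : WithLp 2 (K × K)) :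
    (triangular a b w).snd = a w.snd := rfl

theorem withLp_prod_ext {v w : WithLp 2 (K × K)} (h1 : v.fst = w.fst) (h2 : v.snd = w.snd) :
    v = w := by
  apply (WithLp.prodContinuousLinearEquiv 2 ℂ K K).injective
  exact Prod.ext h1 h2

theorem exists_norm_triangular_le (C : ℝ) : ∃ C', ∀ a b : K →L[ℂ] K, ‖a‖ ≤ 1 → ‖b‖ ≤ C →
    ‖triangular a b‖ ≤ C' := by
  refine ⟨‖(WithLp.prodContinuousLinearEquiv 2 ℂ K K).symm.toContinuousLinearMap‖ *
    ((1 + C + 1) * ‖(WithLp.prodContinuousLinearEquiv 2 ℂ K K).toContinuousLinearMap‖),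
    fun a b ha hb => ?_⟩
  refine (ContinuousLinearMap.opNorm_comp_le _ _).trans
    (mul_le_mul_of_nonneg_left ?_ (norm_nonneg _))
  refine (ContinuousLinearMap.opNorm_comp_le _ _).trans
    (mul_le_mul_of_nonneg_right ?_ (norm_nonneg _))
  have hC : 0 ≤ C := (norm_nonneg _).trans hb
  refine ContinuousLinearMap.opNorm_le_bound _ (by positivity) fun p => ?_
  have h1 := norm_fst_le p
  have h2 := norm_snd_le p
  have h3 : ‖a p.1‖ ≤ 1 * ‖p‖ := (a.le_opNorm _).trans
    (mul_le_mul ha h1 (norm_nonneg _) zero_le_one)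
  have h4 : ‖b p.2‖ ≤ C * ‖p‖ := (b.le_opNorm _).trans (mul_le_mul hb h2 (norm_nonneg _) hC)
  have h5 : ‖a p.2‖ ≤ 1 * ‖p‖ := (a.le_opNorm _).trans
    (mul_le_mul ha h2 (norm_nonneg _) zero_le_one)
  have h6 := norm_add_le (a p.1) (b p.2)
  have h7 := mul_nonneg hC (norm_nonneg p)
  refine max_le ?_ ?_
  · change ‖a p.1 + b p.2‖ ≤ _
    linarith [norm_nonneg p]
  · change ‖a p.2‖ ≤ _
    linarith [norm_nonneg p]

theorem exists_inner_of_derivation [CompleteSpace K] (hΓ : IsUnitarizableGroup Γ) (ρ : Γ →* (K →L[ℂ] K))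
    (hρ : ∀ γ, ‖ρ γ‖ ≤ 1) (D : Γ → K →L[ℂ] K) {C : ℝ} (hD : ∀ γ, ‖D γ‖ ≤ C)
    (hD1 : D 1 = 0) (hDmul : ∀ γ δ, D (γ * δ) = ρ γ * D δ + D γ * ρ δ) :
    ∃ B : K →L[ℂ] K, ∀ γ, D γ = B * ρ γ - ρ γ * B := by
  obtain ⟨C', hC'⟩ := exists_norm_triangular_le (K := K) C
  let π : Γ →* (WithLp 2 (K × K) →L[ℂ] WithLp 2 (K × K)) :=
    { toFun := fun γ => triangular (ρ γ) (D γ)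
      map_one' := by
        ext1 w
        apply withLp_prod_ext <;> simp [hD1]
      map_mul' := fun γ δ => by
        ext1 w
        apply withLp_prod_ext <;> simp [hDmul, mul_apply_eq_comp, add_assoc] }
  obtain ⟨S, hS⟩ := hΓ (WithLp 2 (K × K)) π.toHomUnits ⟨C', fun γ => hC' _ _ (hρ γ) (hD γ)⟩
  set U : Γ → (WithLp 2 (K × K) →L[ℂ] WithLp 2 (K × K)) :=
    fun γ => ((S⁻¹ * π.toHomUnits γ * S : (_ →L[ℂ] _)ˣ) : _ →L[ℂ] _) with hU
  have hSS : ∀ w, S.val (S⁻¹.val w) = w := fun w => by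
    rw [← mul_apply_eq_comp, Units.mul_inv]; rfl
  have hSS' : ∀ w, S⁻¹.val (S.val w) = w := fun w => by
    rw [← mul_apply_eq_comp, Units.inv_mul]; rfl
  have hUS : ∀ γ w, S.val (U γ w) = π γ (S.val w) := fun γ w => by
    simp only [hU, Units.val_mul, mul_apply_eq_comp, hSS]
    rfl
  have hUinv : ∀ γ v w, inner ℂ v (U γ w) = inner ℂ (U γ⁻¹ v) w := fun γ v w => by
    have h1 := (Unitary.mem_iff.1 (hS γ)).1
    have h2 : U γ * U γ⁻¹ = 1 := by
      simp only [hU, ← Units.val_mul, map_inv]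
      rw [Units.val_eq_one]
      group
    have h3 : star (U γ) = U γ⁻¹ := by
      calc star (U γ) = star (U γ) * (U γ * U γ⁻¹) := by rw [h2, mul_one]
        _ = U γ⁻¹ := by rw [← mul_assoc, h1, one_mul]
    rw [← h3, ContinuousLinearMap.star_eq_adjoint, ContinuousLinearMap.adjoint_inner_left]
  let sndL : WithLp 2 (K × K) →L[ℂ] K := ContinuousLinearMap.snd ℂ K K ∘L
    (WithLp.prodContinuousLinearEquiv 2 ℂ K K).toContinuousLinearMap
  let fstL : WithLp 2 (K × K) →L[ℂ] K := ContinuousLinearMap.fst ℂ K K ∘L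
    (WithLp.prodContinuousLinearEquiv 2 ℂ K K).toContinuousLinearMap
  let inr : K →L[ℂ] WithLp 2 (K × K) :=
    (WithLp.prodContinuousLinearEquiv 2 ℂ K K).symm.toContinuousLinearMap ∘L
      ContinuousLinearMap.inr ℂ K K
  let L : Submodule ℂ (WithLp 2 (K × K)) := (sndL ∘L S.val).ker
  have hLc : IsClosed (L : Set (WithLp 2 (K × K))) := (sndL ∘L S.val).isClosed_ker
  have : CompleteSpace L := hLc.completeSpace_coe
  have hmem : ∀ w, w ∈ L ↔ (S.val w).snd = 0 := fun w => Iff.rfl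
  have hLU : ∀ γ w, w ∈ L → U γ w ∈ L := fun γ w hw => by
    rw [hmem] at hw ⊢
    rw [hUS]
    change (triangular _ _ _).snd = 0
    rw [triangular_snd, hw, map_zero]
  let P := L.starProjection
  have hPU : ∀ γ w, P (U γ w) = U γ (P w) := fun γ w => by
    refine Submodule.eq_starProjection_of_mem_orthogonal (hLU γ _ (L.starProjection_apply_mem w)) ?_
    rw [← map_sub, Submodule.mem_orthogonal]
    intro u hu
    rw [hUinv]
    exact (Submodule.mem_orthogonal _ _).1 (L.sub_starProjection_mem_orthogonal w) _ (hLU _ _ hu)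
  let E := S.val ∘L (P ∘L S⁻¹.val)
  have hE : ∀ w, E w = S.val (P (S⁻¹.val w)) := fun w => rfl
  have hEπ : ∀ γ w, E (π γ w) = π γ (E w) := fun γ w => by
    rw [hE, hE, ← hUS, ← hPU]
    congr 2
    rw [← hSS' (U γ _), hUS, hSS]
  have hEsnd : ∀ w, (E w).snd = 0 := fun w => (hmem _).1 (L.starProjection_apply_mem _)
  have hEid : ∀ w : WithLp 2 (K × K), w.snd = 0 → E w = w := fun w hw => by
    rw [hE, Submodule.starProjection_eq_self_iff.2, hSS]
    rw [hmem, hSS, hw]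
  refine ⟨-(fstL ∘L (E ∘L inr)), fun γ => ?_⟩
  ext y
  have h1 := hEπ γ (inr y)
  have h2 : π γ (inr y) = WithLp.toLp 2 (D γ y, (0 : K)) + inr (ρ γ y) := by
    apply withLp_prod_ext
    · change ρ γ 0 + D γ y = D γ y + 0
      rw [map_zero, zero_add, add_zero]
    · change ρ γ y = 0 + ρ γ y
      rw [zero_add]
  rw [h2, map_add, hEid _ rfl] at h1
  have h3 := congrArg (fun w => fstL w) h1
  have h4 : fstL (π γ (E (inr y))) = ρ γ (fstL (E (inr y))) := by
    change ρ γ (E (inr y)).fst + D γ (E (inr y)).snd = _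
    rw [hEsnd, map_zero, add_zero]
    rfl
  simp only [map_add, h4] at h3
  change D γ y + fstL (E (inr (ρ γ y))) = _ at h3
  change D γ y = -(fstL (E (inr (ρ γ y)))) - ρ γ (-(fstL (E (inr y))))
  rw [map_neg, ← h3]
  abel

end Derivation

section DirectSum

variable {H : ℕ → Type} [∀ n, NormedAddCommGroup (H n)] [∀ n, InnerProductSpace ℂ (H n)]

theorem memℓp_diag (f : lp H 2) {b : ∀ n, H n →L[ℂ] H n} {C : ℝ} (hb : ∀ n, ‖b n‖ ≤ C) :
    Memℓp (fun n => b n (f n)) 2 := by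
  have h2 : 0 < (2 : ENNReal).toReal := by norm_num
  have hC : 0 ≤ C := (norm_nonneg _).trans (hb 0)
  refine memℓp_gen (Summable.of_nonneg_of_le (fun n => by positivity) (fun n => ?_)
    (((lp.memℓp f).summable h2).mul_left (C ^ (2 : ENNReal).toReal)))
  rw [← Real.mul_rpow hC (norm_nonneg _)]
  exact Real.rpow_le_rpow (norm_nonneg _)
    (((b n).le_opNorm _).trans (mul_le_mul_of_nonneg_right (hb n) (norm_nonneg _))) h2.le

/-- The diagonal operator on the Hilbert sum defined by a bounded family of operators. -/
noncomputable def lpDiag (b : ∀ n, H n →L[ℂ] H n) {C : ℝ} (hb : ∀ n, ‖b n‖ ≤ C) :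
    lp H 2 →L[ℂ] lp H 2 :=
  LinearMap.mkContinuous
    { toFun := fun f => ⟨fun n => b n (f n), memℓp_diag f hb⟩
      map_add' := fun f g => by ext n; exact map_add (b n) _ _
      map_smul' := fun c f => by ext n; exact map_smul (b n) _ _ } C fun f => by
    have h2 : 0 < (2 : ENNReal).toReal := by norm_num
    have hC : 0 ≤ C := (norm_nonneg _).trans (hb 0)
    refine lp.norm_le_of_forall_sum_le h2 (by positivity) fun s => ?_
    rw [Real.mul_rpow hC (norm_nonneg _)]
    refine le_trans ?_ (mul_le_mul_of_nonneg_left (lp.sum_rpow_le_norm_rpow h2 f s)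
      (by positivity))
    rw [Finset.mul_sum]
    refine Finset.sum_le_sum fun n _ => ?_
    rw [← Real.mul_rpow hC (norm_nonneg _)]
    exact Real.rpow_le_rpow (norm_nonneg _)
      (((b n).le_opNorm _).trans (mul_le_mul_of_nonneg_right (hb n) (norm_nonneg _))) h2.le

@[simp]
theorem lpDiag_apply (b : ∀ n, H n →L[ℂ] H n) {C : ℝ} (hb : ∀ n, ‖b n‖ ≤ C) (f : lp H 2) (n : ℕ) :
    lpDiag b hb f n = b n (f n) := rfl

theorem norm_lpDiag_le (b : ∀ n, H n →L[ℂ] H n) {C : ℝ} (hb : ∀ n, ‖b n‖ ≤ C) :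
    ‖lpDiag b hb‖ ≤ C :=
  LinearMap.mkContinuous_norm_le _ ((norm_nonneg _).trans (hb 0)) _

/-- Bounded inner derivations of contractive representations of a unitarizable group are
realised with a uniform bound. -/
theorem IsUnitarizableGroup.exists_uniform_bound [∀ n, CompleteSpace (H n)] {Γ : Type} [Group Γ]
    (hΓ : IsUnitarizableGroup Γ) (ρ : ∀ n, Γ →* (H n →L[ℂ] H n)) (hρ : ∀ n γ, ‖ρ n γ‖ ≤ 1)
    (T : ∀ n, H n →L[ℂ] H n) {C : ℝ} (hT : ∀ n γ, ‖T n * ρ n γ - ρ n γ * T n‖ ≤ C) :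
    ∃ K, ∀ n, ∃ B : H n →L[ℂ] H n, ‖B‖ ≤ K ∧
      ∀ γ, T n * ρ n γ - ρ n γ * T n = B * ρ n γ - ρ n γ * B := by
  let R : Γ →* (lp H 2 →L[ℂ] lp H 2) :=
    { toFun := fun γ => lpDiag (fun n => ρ n γ) fun n => hρ n γ
      map_one' := by ext f n; simp
      map_mul' := fun γ δ => by ext f n; simp [mul_apply_eq_comp] }
  let D : Γ → lp H 2 →L[ℂ] lp H 2 := fun γ =>
    lpDiag (fun n => T n * ρ n γ - ρ n γ * T n) fun n => hT n γ
  obtain ⟨B, hB⟩ := exists_inner_of_derivation hΓ R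
    (fun γ => norm_lpDiag_le _ fun n => hρ n γ) D (fun γ => norm_lpDiag_le _ fun n => hT n γ)
    (by ext f n; simp [D]) fun γ δ => by
      ext f n
      simp [D, R, mul_apply_eq_comp]
  refine ⟨‖B‖, fun n => ?_⟩
  have hs : ∀ γ (v : H n), R γ (lp.single 2 n v) = lp.single 2 n (ρ n γ v) := fun γ v => by
    ext k
    change ρ k γ (lp.single 2 n v k) = _
    rcases eq_or_ne k n with rfl | hk
    · rw [lp.single_apply_self, lp.single_apply_self]
    · rw [lp.single_apply_ne _ _ _ hk, lp.single_apply_ne _ _ _ hk, map_zero]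
  let Bn : H n →L[ℂ] H n := LinearMap.mkContinuous
    { toFun := fun v => B (lp.single 2 n v) n
      map_add' := fun v w => by rw [lp.single_add, map_add]; rfl
      map_smul' := fun c v => by rw [lp.single_smul, map_smul]; rfl } ‖B‖ fun v => by
    refine (lp.norm_apply_le_norm (by norm_num) _ n).trans ((B.le_opNorm _).trans ?_)
    rw [lp.norm_single (by norm_num)]
  refine ⟨Bn, LinearMap.mkContinuous_norm_le _ (norm_nonneg _) _, fun γ => ?_⟩
  ext v
  have h1 := congrArg (fun X : lp H 2 →L[ℂ] lp H 2 => X (lp.single 2 n v) n) (hB γ)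
  have h2 : D γ (lp.single 2 n v) n = (T n * ρ n γ - ρ n γ * T n) v := by
    simp [D]
  have h3 : (B * R γ - R γ * B) (lp.single 2 n v) n = (Bn * ρ n γ - ρ n γ * Bn) v := by
    change B (R γ (lp.single 2 n v)) n - ρ n γ (B (lp.single 2 n v) n) = _
    rw [hs]
    rfl
  rw [← h2, ← h3]
  exact h1

end DirectSum

section Characters

/-- The embedding of `ℚ / ℤ` into the multiplicative group of complex numbers. -/
noncomputable def expRatCircle : Multiplicative (AddCircle (1 : ℚ)) →* ℂ :=
  ((Units.coeHom ℂ).comp (AddMonoidHom.toMultiplicativeLeft (QuotientAddGroup.lift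
    (AddSubgroup.zmultiples (1 : ℚ))
    { toFun := fun q : ℚ => Additive.ofMul
        (Units.mk0 (Complex.exp (2 * Real.pi * Complex.I * q)) (Complex.exp_ne_zero _))
      map_zero' := by
        apply Additive.toMul.injective
        ext
        simp
      map_add' := fun p q => by
        apply Additive.toMul.injective
        ext
        simp [mul_add, Complex.exp_add] }
    fun q hq => by
      obtain ⟨n, rfl⟩ := AddSubgroup.mem_zmultiples_iff.1 hq
      apply Additive.toMul.injective
      ext
      simp only [AddMonoidHom.coe_mk, ZeroHom.coe_mk]
      refine Complex.exp_eq_one_iff.2 ⟨n, ?_⟩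
      simp
      ring)))

theorem expRatCircle_apply (q : ℚ) :
    expRatCircle (Multiplicative.ofAdd (q : AddCircle (1 : ℚ))) =
      Complex.exp (2 * Real.pi * Complex.I * q) := rfl

theorem norm_expRatCircle (z : Multiplicative (AddCircle (1 : ℚ))) : ‖expRatCircle z‖ = 1 := by
  obtain ⟨q, hq⟩ := QuotientAddGroup.mk_surjective z.toAdd
  have : z = Multiplicative.ofAdd (q : AddCircle (1 : ℚ)) := by
    apply Multiplicative.toAdd.injective
    exact hq.symm
  rw [this, expRatCircle_apply, Complex.norm_exp]
  simp

theorem expRatCircle_injective : Function.Injective expRatCircle := by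
  rw [injective_iff_map_eq_one]
  intro z hz
  obtain ⟨q, hq⟩ := QuotientAddGroup.mk_surjective z.toAdd
  have : z = Multiplicative.ofAdd (q : AddCircle (1 : ℚ)) := by
    apply Multiplicative.toAdd.injective
    exact hq.symm
  rw [this, expRatCircle_apply, Complex.exp_eq_one_iff] at hz
  obtain ⟨n, hn⟩ := hz
  have h1 : (q : ℂ) = n := by
    have h2 : (2 * Real.pi * Complex.I : ℂ) ≠ 0 := Complex.two_pi_I_ne_zero
    apply mul_left_cancel₀ h2
    rw [hn]
    ring
  have h3 : q = n := by exact_mod_cast h1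
  rw [this]
  apply Multiplicative.toAdd.injective
  rw [toAdd_ofAdd, toAdd_one, h3]
  exact (AddCircle.coe_eq_zero_iff (1 : ℚ)).2 ⟨n, by simp⟩

theorem infinite_characterModule (A : Type) [AddCommGroup A] [Infinite A] :
    Infinite (CharacterModule A) := by
  by_contra hfin
  rw [not_infinite_iff_finite] at hfin
  have hn : 0 < Nat.card (CharacterModule A) := Nat.card_pos
  set n := Nat.card (CharacterModule A) with hn'
  have htors : {u : AddCircle (1 : ℚ) | n • u = 0}.Finite := by
    exact AddCircle.finite_torsion (1 : ℚ) hn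
  have := htors.to_subtype
  let F : A → CharacterModule A → {u : AddCircle (1 : ℚ) | n • u = 0} := fun a c =>
    ⟨c a, by
      have h1 : n • c = 0 := card_nsmul_eq_zero'
      have h2 := congrArg (fun c' : CharacterModule A => c' a) h1
      exact h2⟩
  refine not_injective_infinite_finite F fun a b hab => ?_
  by_contra hne
  obtain ⟨c, hc⟩ := CharacterModule.exists_character_apply_ne_zero_of_ne_zero (sub_ne_zero.2 hne)
  apply hc
  rw [map_sub, sub_eq_zero]
  exact congrArg Subtype.val (congrFun hab c)

/-- An infinite abelian group has arbitrarily many unitary characters. -/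
theorem exists_characters (A : Type) [CommGroup A] [Infinite A] (Y : Type) [Finite Y] :
    ∃ χ : Y → A →* ℂ, Function.Injective χ ∧ ∀ y a, ‖χ y a‖ = 1 := by
  have := infinite_characterModule (Additive A)
  obtain ⟨n, ⟨e⟩⟩ := Finite.exists_equiv_fin Y
  let emb : Y ↪ CharacterModule (Additive A) :=
    (e.toEmbedding.trans Fin.valEmbedding).trans (Infinite.natEmbedding _)
  refine ⟨fun y => expRatCircle.comp (AddMonoidHom.toMultiplicativeRight (emb y)), ?_, ?_⟩
  · intro y y' h
    apply emb.injective
    ext a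
    have := DFunLike.congr_fun h a.toMul
    exact expRatCircle_injective this
  · intro y a
    exact norm_expRatCircle _

/-- Distinct characters of a group separate the points of a finite index set linearly. -/
theorem span_characters_eq_top {A Y : Type} [Group A] [Finite Y] {χ : Y → A →* ℂ}
    (hχ : Function.Injective χ) :
    Submodule.span ℂ (Set.range fun a : A => fun y => χ y a) = ⊤ := by
  classical
  have := Fintype.ofFinite Y
  by_contra hne
  obtain ⟨f, hf0, hf⟩ := Submodule.exists_le_ker_of_lt_top _ (lt_top_iff_ne_top.2 hne)
  have hind := (linearIndependent_monoidHom A ℂ).comp χ hχ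
  rw [Fintype.linearIndependent_iff] at hind
  apply hf0
  have h1 : ∀ y, f (Pi.single y 1) = 0 := hind (fun y => f (Pi.single y 1)) (by
    ext a
    have h2 : f (fun y => χ y a) = 0 := hf (Submodule.subset_span ⟨a, rfl⟩)
    rw [LinearMap.pi_apply_eq_sum_univ f] at h2
    simp only [Function.comp_apply, Finset.sum_apply, Pi.smul_apply, smul_eq_mul, Pi.zero_apply]
    rw [← h2]
    refine Finset.sum_congr rfl fun y _ => ?_
    rw [smul_eq_mul, mul_comm]
    congr 2
    ext z
    simp [Pi.single_apply, eq_comm])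
  refine LinearMap.pi_ext' fun y => ?_
  ext
  simpa using h1 y

end Characters

section WreathRepresentation
open MeasureTheory

variable {G A X Y : Type} [CommGroup A]

/-- The product over the sites `t` of the characters `χ (y t x)` evaluated at `a t`. -/
noncomputable def characterProd (χ : Y → A →* ℂ) (y : G → X → Y) (a : finSupp G A) (x : X) : ℂ :=
  ∏ᶠ t, χ (y t x) ((a : G → A) t)

theorem characterProd_eq_prod (χ : Y → A →* ℂ) (y : G → X → Y) (a : finSupp G A) (x : X) :
    characterProd χ y a x = ∏ t ∈ a.2.toFinset, χ (y t x) ((a : G → A) t) := by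
  refine finprod_eq_prod_of_mulSupport_subset _ fun t ht => ?_
  exact (Set.Finite.mem_toFinset _).2 fun h => ht (by simp [h])

theorem finite_mulSupport_character (χ : Y → A →* ℂ) (y : G → X → Y) (a : finSupp G A) (x : X) :
    (Function.mulSupport fun t => χ (y t x) ((a : G → A) t)).Finite :=
  a.2.subset fun t ht h => ht (by simp [h])

theorem characterProd_one (χ : Y → A →* ℂ) (y : G → X → Y) (x : X) :
    characterProd χ y (1 : finSupp G A) x = 1 := by
  simp [characterProd]

theorem characterProd_mul (χ : Y → A →* ℂ) (y : G → X → Y) (a b : finSupp G A) (x : X) :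
    characterProd χ y (a * b) x = characterProd χ y a x * characterProd χ y b x := by
  unfold characterProd
  rw [← finprod_mul_distrib (finite_mulSupport_character χ y a x)
    (finite_mulSupport_character χ y b x)]
  simp

theorem characterProd_single (χ : Y → A →* ℂ) (y : G → X → Y) (g : G) (a : A) (x : X) :
    characterProd χ y (finSuppSingle g a) x = χ (y g x) a := by
  unfold characterProd
  rw [finprod_eq_single _ g fun t ht => by simp [finSuppSingle_of_ne ht], finSuppSingle_same]

theorem norm_characterProd {χ : Y → A →* ℂ} (hχ : ∀ y a, ‖χ y a‖ = 1) (y : G → X → Y)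
    (a : finSupp G A) (x : X) : ‖characterProd χ y a x‖ = 1 := by
  rw [characterProd_eq_prod, norm_prod]
  exact Finset.prod_eq_one fun t _ => hχ _ _

theorem characterProd_shift [Group G] [MulAction G X] (χ : Y → A →* ℂ) {y : G → X → Y}
    (hye : ∀ g t x, y t (g • x) = y (g⁻¹ * t) x) (g : G) (a : finSupp G A) (x : X) :
    characterProd χ y (shiftHom A G g a) x = characterProd χ y a (g⁻¹ • x) := by
  unfold characterProd
  simp only [hye, inv_inv]
  rw [← finprod_comp_equiv (Equiv.mulLeft g)]
  refine finprod_congr fun t => ?_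
  simp [shiftHom, shiftEquiv]

variable [MeasurableSpace X] [MeasurableSpace Y] [DiscreteMeasurableSpace Y]

theorem measurable_characterProd (χ : Y → A →* ℂ) {y : G → X → Y} (hy : ∀ t, Measurable (y t))
    (a : finSupp G A) : Measurable (characterProd χ y a) := by
  have : characterProd χ y a = fun x => ∏ t ∈ a.2.toFinset, χ (y t x) ((a : G → A) t) :=
    funext (characterProd_eq_prod χ y a)
  rw [this]
  exact Finset.measurable_prod _ fun t _ =>
    (Measurable.of_discrete (f := fun z : Y => χ z ((a : G → A) t))).comp (hy t)

/-- Multiplication by a bounded measurable function of the first variable. -/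
noncomputable def fstMul (μ : Measure X) (G : Type) [MeasurableSpace G] {φ : X → ℂ}
    (hφ : Measurable φ) (hb : ∃ C, ∀ x, ‖φ x‖ ≤ C) :
    Lp ℂ 2 (μ.prod (Measure.count : Measure G)) →L[ℂ]
      Lp ℂ 2 (μ.prod (Measure.count : Measure G)) :=
  (WeightedMap.ofWeight (μ := μ.prod (Measure.count : Measure G)) (φ := fun z => φ z.1)
    (hφ.comp measurable_fst) (hb.imp fun _ h z => h z.1)).op

theorem norm_fstMul_le (μ : Measure X) (G : Type) [MeasurableSpace G] {φ : X → ℂ} (hφ : Measurable φ) {C : ℝ}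
    (hC0 : 0 ≤ C) (hC : ∀ x, ‖φ x‖ ≤ C) : ‖fstMul μ G hφ ⟨C, hC⟩‖ ≤ C :=
  WeightedMap.norm_op_le _ hC0 fun z => hC z.1

variable [Group G] [MulAction G X] [MeasurableConstSMul G X] [MeasurableSpace G] [DiscreteMeasurableSpace G]
  [Countable G]

theorem measurePreserving_diagonal (μ : Measure X) [IsProbabilityMeasure μ]
    [SMulInvariantMeasure G X μ] (g : G) :
    MeasurePreserving (fun z : X × G => (g⁻¹ • z.1, g⁻¹ * z.2)) (μ.prod Measure.count)
      (μ.prod Measure.count) :=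
  (measurePreserving_smul g⁻¹ μ).prod (measurePreserving_count_equiv (Equiv.mulLeft g⁻¹))

/-- The Koopman operator of the diagonal action on `X × G`. -/
noncomputable def koopman (μ : Measure X) [IsProbabilityMeasure μ] [SMulInvariantMeasure G X μ]
    (g : G) : Lp ℂ 2 (μ.prod (Measure.count : Measure G)) →L[ℂ]
      Lp ℂ 2 (μ.prod (Measure.count : Measure G)) :=
  (WeightedMap.ofMap (measurePreserving_diagonal μ g)).op

/-- The unitary representation of the wreath product on `L²(X × G)` for which the base group
acts by multiplication by products of characters. -/
noncomputable def wreathRep (μ : Measure X) [IsProbabilityMeasure μ] [SMulInvariantMeasure G X μ]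
    {χ : Y → A →* ℂ} (hχ : ∀ y a, ‖χ y a‖ = 1) {y : G → X → Y} (hy : ∀ t, Measurable (y t))
    (hye : ∀ g t x, y t (g • x) = y (g⁻¹ * t) x) :
    Wreath A G →* (Lp ℂ 2 (μ.prod (Measure.count : Measure G)) →L[ℂ]
      Lp ℂ 2 (μ.prod (Measure.count : Measure G))) where
  toFun w := fstMul μ G (measurable_characterProd χ hy w.left)
    ⟨1, fun x => (norm_characterProd hχ y w.left x).le⟩ * koopman μ w.right
  map_one' := by
    unfold fstMul koopman
    rw [WeightedMap.op_mul]
    refine WeightedMap.op_eq_one (fun z => ?_) fun z => ?_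
    · simp [WeightedMap.comp, WeightedMap.ofMap, WeightedMap.ofWeight, characterProd_one]
    · simp [WeightedMap.comp, WeightedMap.ofMap, WeightedMap.ofWeight]
  map_mul' w w' := by
    unfold fstMul koopman
    simp only [WeightedMap.op_mul]
    refine WeightedMap.op_congr (fun z => ?_) fun z => ?_
    · simp [WeightedMap.comp, WeightedMap.ofMap, WeightedMap.ofWeight, characterProd_mul,
        characterProd_shift χ hye]
    · simp [WeightedMap.comp, WeightedMap.ofMap, WeightedMap.ofWeight, mul_smul, mul_assoc]

variable (μ : Measure X) [IsProbabilityMeasure μ] [SMulInvariantMeasure G X μ]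
    {χ : Y → A →* ℂ} (hχ : ∀ y a, ‖χ y a‖ = 1) {y : G → X → Y} (hy : ∀ t, Measurable (y t))
    (hye : ∀ g t x, y t (g • x) = y (g⁻¹ * t) x)

theorem wreathRep_apply (w : Wreath A G) : wreathRep μ hχ hy hye w =
    fstMul μ G (measurable_characterProd χ hy w.left)
    ⟨1, fun x => (norm_characterProd hχ y w.left x).le⟩ * koopman μ w.right := rfl

theorem norm_koopman_le (g : G) : ‖koopman μ g‖ ≤ 1 :=
  WeightedMap.norm_op_le _ zero_le_one fun z => by simp [WeightedMap.ofMap]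

theorem koopman_one : koopman μ (1 : G) = 1 :=
  WeightedMap.op_eq_one (fun z => rfl) fun z => by simp [WeightedMap.ofMap]

theorem koopman_mul (g h : G) : koopman μ (g * h) = koopman μ g * koopman μ h := by
  unfold koopman
  rw [WeightedMap.op_mul]
  refine WeightedMap.op_congr (fun z => ?_) fun z => ?_
  · simp [WeightedMap.comp, WeightedMap.ofMap]
  · simp [WeightedMap.comp, WeightedMap.ofMap, mul_smul, mul_assoc]

theorem norm_wreathRep_le (w : Wreath A G) : ‖wreathRep μ hχ hy hye w‖ ≤ 1 := by
  rw [wreathRep_apply]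
  refine (norm_mul_le _ _).trans (mul_le_one₀ ?_ (norm_nonneg _) (norm_koopman_le μ _))
  exact norm_fstMul_le μ G _ zero_le_one fun x => (norm_characterProd hχ y w.left x).le

end WreathRepresentation

theorem norm_indicator_one_le {X : Type} (C : Set X) (x : X) : ‖C.indicator (1 : X → ℂ) x‖ ≤ 1 := by
  by_cases h : x ∈ C <;> simp [h]

theorem exists_norm_comp_le {X Y : Type} [Finite Y] (F : Y → ℂ) (v : X → Y) : ∃ C, ∀ x, ‖F (v x)‖ ≤ C := by
  obtain ⟨C, hC⟩ := (Set.finite_range fun c => ‖F c‖).bddAbove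
  exact ⟨C, fun x => hC ⟨v x, rfl⟩⟩

section FirstVariable
open MeasureTheory

variable {G X : Type} [MeasurableSpace G] [MeasurableSpace X] {μ : Measure X}

theorem coeFn_fstMul {φ : X → ℂ} (hφ : Measurable φ) (hb : ∃ C, ∀ x, ‖φ x‖ ≤ C)
    (f : Lp ℂ 2 (μ.prod (Measure.count : Measure G))) :
    fstMul μ G hφ hb f =ᵐ[μ.prod Measure.count] fun z => φ z.1 * f z :=
  WeightedMap.coeFn_op _ f

theorem fstMul_congr {φ ψ : X → ℂ} {hφ : Measurable φ} {hb : ∃ C, ∀ x, ‖φ x‖ ≤ C}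
    {hψ : Measurable ψ} {hb' : ∃ C, ∀ x, ‖ψ x‖ ≤ C} (h : ∀ x, φ x = ψ x) :
    fstMul μ G hφ hb = fstMul μ G hψ hb' :=
  WeightedMap.op_congr (fun z => h z.1) fun _ => rfl

theorem fstMul_add {φ ψ θ : X → ℂ} {hφ : Measurable φ} {hb : ∃ C, ∀ x, ‖φ x‖ ≤ C}
    {hψ : Measurable ψ} {hb' : ∃ C, ∀ x, ‖ψ x‖ ≤ C} {hθ : Measurable θ}
    {hb'' : ∃ C, ∀ x, ‖θ x‖ ≤ C} (h : ∀ x, θ x = φ x + ψ x) :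
    fstMul μ G hθ hb'' = fstMul μ G hφ hb + fstMul μ G hψ hb' := by
  ext1 f
  refine Lp.ext ?_
  filter_upwards [coeFn_fstMul hφ hb f, coeFn_fstMul hψ hb' f, coeFn_fstMul hθ hb'' f,
    Lp.coeFn_add (fstMul μ G hφ hb f) (fstMul μ G hψ hb' f)] with z h1 h2 h3 h4
  rw [add_apply, h4, Pi.add_apply, h1, h2, h3, h, add_mul]

theorem fstMul_smul {φ θ : X → ℂ} {hφ : Measurable φ} {hb : ∃ C, ∀ x, ‖φ x‖ ≤ C}
    {hθ : Measurable θ} {hb'' : ∃ C, ∀ x, ‖θ x‖ ≤ C} (c : ℂ) (h : ∀ x, θ x = c * φ x) :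
    fstMul μ G hθ hb'' = c • fstMul μ G hφ hb := by
  ext1 f
  refine Lp.ext ?_
  filter_upwards [coeFn_fstMul hφ hb f, coeFn_fstMul hθ hb'' f,
    Lp.coeFn_smul c (fstMul μ G hφ hb f)] with z h1 h3 h4
  rw [_root_.smul_apply, h4, Pi.smul_apply, h1, h3, h, smul_eq_mul, mul_assoc]

theorem fstMul_mul {φ ψ θ : X → ℂ} {hφ : Measurable φ} {hb : ∃ C, ∀ x, ‖φ x‖ ≤ C}
    {hψ : Measurable ψ} {hb' : ∃ C, ∀ x, ‖ψ x‖ ≤ C} {hθ : Measurable θ}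
    {hb'' : ∃ C, ∀ x, ‖θ x‖ ≤ C} (h : ∀ x, θ x = φ x * ψ x) :
    fstMul μ G hθ hb'' = fstMul μ G hφ hb * fstMul μ G hψ hb' := by
  unfold fstMul
  rw [WeightedMap.op_mul]
  exact WeightedMap.op_congr (fun z => h z.1) fun _ => rfl

/-- Multiplication by the indicator function of a measurable subset of the first variable. -/
noncomputable def fstInd (μ : Measure X) (G : Type) [MeasurableSpace G] {C : Set X}
    (hC : MeasurableSet C) : Lp ℂ 2 (μ.prod (Measure.count : Measure G)) →L[ℂ]
      Lp ℂ 2 (μ.prod (Measure.count : Measure G)) :=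
  fstMul μ G (measurable_one.indicator hC) ⟨1, norm_indicator_one_le C⟩

theorem coeFn_fstInd {C : Set X} (hC : MeasurableSet C)
    (f : Lp ℂ 2 (μ.prod (Measure.count : Measure G))) :
    fstInd μ G hC f =ᵐ[μ.prod Measure.count] fun z => C.indicator 1 z.1 * f z :=
  coeFn_fstMul _ _ f

theorem inner_fstInd {C : Set X} (hC : MeasurableSet C)
    (f h : Lp ℂ 2 (μ.prod (Measure.count : Measure G))) :
    inner ℂ h (fstInd μ G hC f) =
      ∫ z in Prod.fst ⁻¹' C, inner ℂ (h z) (f z) ∂(μ.prod Measure.count) := by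
  rw [L2.inner_def, ← integral_indicator (measurable_fst hC)]
  refine integral_congr_ae ?_
  filter_upwards [coeFn_fstInd hC f] with z hz
  rw [hz]
  by_cases h : z.1 ∈ C <;> simp [h, Set.indicator]

theorem tendsto_inner_fstInd {D : ℕ → Set X} (hD : ∀ n, MeasurableSet (D n)) (hm : Monotone D)
    (f h : Lp ℂ 2 (μ.prod (Measure.count : Measure G))) :
    Tendsto (fun n => inner ℂ h (fstInd μ G (hD n) f)) atTop
      (𝓝 (inner ℂ h (fstInd μ G (MeasurableSet.iUnion hD) f))) := by
  simp only [inner_fstInd, Set.preimage_iUnion]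
  exact tendsto_setIntegral_of_monotone (fun n => measurable_fst (hD n))
    (fun i j hij => Set.preimage_mono (hm hij)) (L2.integrable_inner h f).integrableOn

theorem commute_fstInd_iUnion_of_monotone {D : ℕ → Set X} (hD : ∀ n, MeasurableSet (D n))
    (hm : Monotone D) {T : Lp ℂ 2 (μ.prod (Measure.count : Measure G)) →L[ℂ]
      Lp ℂ 2 (μ.prod (Measure.count : Measure G))}
    (hT : ∀ n, Commute T (fstInd μ G (hD n))) :
    Commute T (fstInd μ G (MeasurableSet.iUnion hD)) := by
  refine ContinuousLinearMap.ext fun f => ext_inner_left ℂ fun h => ?_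
  have h1 := tendsto_inner_fstInd hD hm f (ContinuousLinearMap.adjoint T h)
  have h2 := tendsto_inner_fstInd hD hm (T f) h
  simp only [ContinuousLinearMap.adjoint_inner_left] at h1
  refine tendsto_nhds_unique (h1.congr fun n => ?_) h2
  have := congrArg (fun S => S f) (hT n).eq
  simp only [mul_apply_eq_comp] at this
  rw [this]

theorem fstInd_univ : fstInd μ G MeasurableSet.univ = 1 :=
  WeightedMap.op_eq_one (fun z => by simp [WeightedMap.ofWeight]) fun z => rfl

theorem fstInd_inter {C D : Set X} (hC : MeasurableSet C) (hD : MeasurableSet D) :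
    fstInd μ G (hC.inter hD) = fstInd μ G hC * fstInd μ G hD :=
  fstMul_mul fun x => by
    by_cases h : x ∈ C <;> by_cases h' : x ∈ D <;> simp [h, h']

theorem fstInd_compl {C : Set X} (hC : MeasurableSet C) :
    fstInd μ G hC.compl = 1 - fstInd μ G hC := by
  rw [eq_sub_iff_add_eq, ← fstInd_univ]
  refine (fstMul_add fun x => ?_).symm
  by_cases h : x ∈ C <;> simp [h]

theorem commute_fstInd_compl {C : Set X} (hC : MeasurableSet C)
    {T : Lp ℂ 2 (μ.prod (Measure.count : Measure G)) →L[ℂ]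
      Lp ℂ 2 (μ.prod (Measure.count : Measure G))} (hT : Commute T (fstInd μ G hC)) :
    Commute T (fstInd μ G hC.compl) := by
  rw [fstInd_compl hC]
  exact (Commute.one_right T).sub_right hT

theorem commute_fstInd_union {C D : Set X} (hC : MeasurableSet C) (hD : MeasurableSet D)
    {T : Lp ℂ 2 (μ.prod (Measure.count : Measure G)) →L[ℂ]
      Lp ℂ 2 (μ.prod (Measure.count : Measure G))} (hT : Commute T (fstInd μ G hC))
    (hT' : Commute T (fstInd μ G hD)) :
    Commute T (fstInd μ G (hC.union hD)) := by
  have h := (commute_fstInd_compl hC hT).mul_right (commute_fstInd_compl hD hT')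
  rw [← fstInd_inter] at h
  have h3 := commute_fstInd_compl _ h
  have h2 : (Cᶜ ∩ Dᶜ)ᶜ = C ∪ D := by rw [Set.compl_inter, compl_compl, compl_compl]
  convert h3 using 3
  exact h2.symm

/-- The σ-algebra of the measurable sets whose indicator function commutes with `T`. -/
@[reducible]
def commutingSets (T : Lp ℂ 2 (μ.prod (Measure.count : Measure G)) →L[ℂ]
      Lp ℂ 2 (μ.prod (Measure.count : Measure G))) : MeasurableSpace X where
  MeasurableSet' C := ∃ hC : MeasurableSet C, Commute T (fstInd μ G hC)
  measurableSet_empty := ⟨MeasurableSet.empty, by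
    have : fstInd μ G (MeasurableSet.empty (α := X)) = 0 := by
      have h := fstInd_compl (μ := μ) (G := G) (MeasurableSet.univ (α := X))
      rw [fstInd_univ, sub_self] at h
      rw [← h]
      exact fstMul_congr fun x => by simp
    rw [this]
    exact Commute.zero_right T⟩
  measurableSet_compl C hC := ⟨hC.1.compl, commute_fstInd_compl hC.1 hC.2⟩
  measurableSet_iUnion D hD := by
    have hacc : ∀ n, ∃ h : MeasurableSet (partialSups D n), Commute T (fstInd μ G h) := by
      intro n
      induction n with
      | zero => simpa using hD 0
      | succ n ih =>
        obtain ⟨h, hc⟩ := ih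
        obtain ⟨h', hc'⟩ := hD (n + 1)
        rw [partialSups_add_one]
        exact ⟨h.union h', commute_fstInd_union h h' hc hc'⟩
    have h := commute_fstInd_iUnion_of_monotone (fun n => (hacc n).1) (partialSups D).monotone
      fun n => (hacc n).2
    refine ⟨MeasurableSet.iUnion fun n => (hD n).1, ?_⟩
    convert h using 2
    exact (iSup_partialSups_eq D).symm

end FirstVariable

section Commutant
open MeasureTheory

variable {G A X Y : Type} [Group G] [CommGroup A] [MeasurableSpace X]
  [MeasurableSpace Y] [DiscreteMeasurableSpace Y] [MulAction G X] [MeasurableConstSMul G X]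
  [MeasurableSpace G] [DiscreteMeasurableSpace G] [Countable G]
  {μ : Measure X} [IsProbabilityMeasure μ] [SMulInvariantMeasure G X μ]
  {χ : Y → A →* ℂ} {y : G → X → Y}

theorem commute_koopman_of_commute_wreathRep (hχ : ∀ y a, ‖χ y a‖ = 1)
    (hy : ∀ t, Measurable (y t)) (hye : ∀ g t x, y t (g • x) = y (g⁻¹ * t) x)
    {T : Lp ℂ 2 (μ.prod (Measure.count : Measure G)) →L[ℂ]
      Lp ℂ 2 (μ.prod (Measure.count : Measure G))}
    (hT : ∀ w, Commute T (wreathRep μ hχ hy hye w)) (g : G) : Commute T (koopman μ g) := by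
  have h := hT (SemidirectProduct.inr g)
  rw [wreathRep_apply] at h
  have h1 : fstMul μ G (measurable_characterProd χ hy (SemidirectProduct.inr g : Wreath A G).left)
    ⟨1, fun x => (norm_characterProd hχ y (SemidirectProduct.inr g : Wreath A G).left x).le⟩ = 1 :=
    WeightedMap.op_eq_one (fun z => by
      simpa [WeightedMap.ofWeight] using characterProd_one χ y z.1) fun z => rfl
  rw [h1, one_mul] at h
  exact h

theorem commute_fstInd_of_commute_wreathRep [Finite Y] (hχ : ∀ y a, ‖χ y a‖ = 1)
    (hinj : Function.Injective χ)
    (hy : ∀ t, Measurable (y t)) (hye : ∀ g t x, y t (g • x) = y (g⁻¹ * t) x)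
    (hgen : ∀ C : Set X, MeasurableSet C → ∀ m : MeasurableSpace X,
      (∀ t c, MeasurableSet[m] (y t ⁻¹' {c})) → MeasurableSet[m] C)
    {T : Lp ℂ 2 (μ.prod (Measure.count : Measure G)) →L[ℂ]
      Lp ℂ 2 (μ.prod (Measure.count : Measure G))}
    (hT : ∀ w, Commute T (wreathRep μ hχ hy hye w)) {C : Set X} (hC : MeasurableSet C) :
    Commute T (fstInd μ G hC) := by
  have hF : ∀ t (F : Y → ℂ), Commute T (fstMul μ G ((Measurable.of_discrete (f := F)).comp (hy t))
      (exists_norm_comp_le F (y t))) := by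
    intro t F
    have hmem : F ∈ Submodule.span ℂ (Set.range fun a : A => fun y => χ y a) := by
      rw [span_characters_eq_top hinj]
      trivial
    induction hmem using Submodule.span_induction with
    | mem F hF =>
      obtain ⟨a, rfl⟩ := hF
      have h := hT (SemidirectProduct.inl (finSuppSingle t a))
      rw [wreathRep_apply, SemidirectProduct.right_inl, koopman_one, mul_one] at h
      refine (congrArg (Commute T) ?_).mpr h
      exact fstMul_congr fun x => (characterProd_single χ y t a x).symm
    | zero =>
      have := fstMul_smul (μ := μ) (G := G) (hφ := (measurable_zero : Measurable (0 : X → ℂ)))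
        (hb := ⟨0, by simp⟩) (hθ := (Measurable.of_discrete (f := (0 : Y → ℂ))).comp (hy t))
        (hb'' := exists_norm_comp_le 0 (y t)) 0 (by simp)
      rw [this, zero_smul]
      exact Commute.zero_right T
    | add F F' _ _ h h' =>
      exact (congrArg (Commute T) (fstMul_add fun x => rfl)).mpr (h.add_right h')
    | smul c F _ h =>
      exact (congrArg (Commute T) (fstMul_smul c fun x => rfl)).mpr (h.smul_right c)
  obtain ⟨_, h⟩ := hgen C hC (commutingSets T) fun t c => ⟨hy t .of_discrete,
    (congrArg (Commute T) (fstMul_congr fun x => rfl)).mpr (hF t (Set.indicator {c} 1))⟩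
  exact h

end Commutant

section Multigraph

variable {V E : Type}

/-- The edge `e` of the multigraph given by `src` and `tgt` joins `u` and `v`. -/
def Joins (src tgt : E → V) (e : E) (u v : V) : Prop :=
  (src e = u ∧ tgt e = v) ∨ (src e = v ∧ tgt e = u)

theorem Joins.symm {src tgt : E → V} {e : E} {u v : V} (h : Joins src tgt e u v) :
    Joins src tgt e v u := Or.symm h

theorem Joins.eq_or_eq {src tgt : E → V} {e : E} {u v u' v' : V} (h : Joins src tgt e u v)
    (h' : Joins src tgt e u' v') : (u = u' ∧ v = v') ∨ (u = v' ∧ v = u') := by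
  rcases h with ⟨rfl, rfl⟩ | ⟨rfl, rfl⟩ <;> rcases h' with ⟨rfl, rfl⟩ | ⟨rfl, rfl⟩ <;> simp

/-- The vertices `u` and `v` are connected after deleting the edge `e`. -/
def ReachAvoiding (src tgt : E → V) (e : E) : V → V → Prop :=
  Relation.ReflTransGen fun u v => ∃ f, f ≠ e ∧ Joins src tgt f u v

theorem ReachAvoiding.symm {src tgt : E → V} {e : E} {u v : V}
    (h : ReachAvoiding src tgt e u v) : ReachAvoiding src tgt e v u := by
  have : Std.Symm fun u v => ∃ f, f ≠ e ∧ Joins src tgt f u v :=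
    ⟨fun u v ⟨f, hf, hj⟩ => ⟨f, hf, hj.symm⟩⟩
  exact Std.Symm.symm (r := Relation.ReflTransGen fun u v => ∃ f, f ≠ e ∧ Joins src tgt f u v) _ _ h

theorem ReachAvoiding.trans {src tgt : E → V} {e : E} {u v w : V}
    (h : ReachAvoiding src tgt e u v) (h' : ReachAvoiding src tgt e v w) :
    ReachAvoiding src tgt e u w := Relation.ReflTransGen.trans h h'

theorem ReachAvoiding.refl (src tgt : E → V) (e : E) (u : V) : ReachAvoiding src tgt e u u :=
  Relation.ReflTransGen.refl

theorem ReachAvoiding.of_joins {src tgt : E → V} {e f : E} (hf : f ≠ e) {u v : V}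
    (h : Joins src tgt f u v) : ReachAvoiding src tgt e u v :=
  Relation.ReflTransGen.single ⟨f, hf, h⟩

theorem ReachAvoiding.map {src tgt src' tgt' : E → V} {fV : V → V} {fE : E → E}
    (hE : Function.Injective fE) (hs : ∀ e, src' (fE e) = fV (src e))
    (ht : ∀ e, tgt' (fE e) = fV (tgt e)) {e : E} {u v : V} (h : ReachAvoiding src tgt e u v) :
    ReachAvoiding src' tgt' (fE e) (fV u) (fV v) := by
  refine Relation.ReflTransGen.lift fV (fun a b ⟨f, hf, hj⟩ => ⟨fE f, hE.ne hf, ?_⟩) _ _ h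
  rcases hj with ⟨rfl, rfl⟩ | ⟨rfl, rfl⟩
  · exact Or.inl ⟨hs f, ht f⟩
  · exact Or.inr ⟨hs f, ht f⟩

/-- The bridge `e` joins `p` and `c`, and the component of `p` in the complement of `e`
contains a vertex whose label is smaller than all the labels in the component of `c`. -/
structure IsParent (src tgt : E → V) (enc : V → ℕ) (e : E) (p c : V) : Prop where
  joins : Joins src tgt e p c
  bridge : ¬ ReachAvoiding src tgt e p c
  small : ∃ u, ReachAvoiding src tgt e p u ∧ ∀ w, ReachAvoiding src tgt e c w → enc u < enc w

variable {src tgt : E → V} {enc : V → ℕ} {e e' : E} {p p' c : V}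

theorem IsParent.reachAvoiding (h : IsParent src tgt enc e p c) (h' : IsParent src tgt enc e' p' c)
    (hne : e ≠ e') {w : V} (hw : ReachAvoiding src tgt e' p' w) : ReachAvoiding src tgt e c w := by
  induction hw with
  | refl => exact .of_joins hne.symm h'.joins.symm
  | @tail v w hv hvw ih =>
    obtain ⟨f, hf, hj⟩ := hvw
    by_cases hfe : f = e
    · subst hfe
      exfalso
      rcases hj.eq_or_eq h.joins with ⟨rfl, rfl⟩ | ⟨rfl, rfl⟩
      · exact h'.bridge (Relation.ReflTransGen.tail hv ⟨f, hf, hj⟩)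
      · exact h'.bridge hv
    · exact ih.trans (.of_joins hfe hj)

theorem IsParent.unique_edge (h : IsParent src tgt enc e p c)
    (h' : IsParent src tgt enc e' p' c) : e = e' := by
  by_contra hne
  obtain ⟨u, hu, hmin⟩ := h.small
  obtain ⟨u', hu', hmin'⟩ := h'.small
  exact lt_asymm (hmin u' (h.reachAvoiding h' hne hu'))
    (hmin' u (h'.reachAvoiding h (Ne.symm hne) hu))

theorem isParent_or_isParent (henc : Function.Injective enc)
    (hb : ¬ ReachAvoiding src tgt e (src e) (tgt e)) (h : ¬ IsParent src tgt enc e (src e) (tgt e)) :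
    IsParent src tgt enc e (tgt e) (src e) := by
  refine ⟨Or.inr ⟨rfl, rfl⟩, fun h => hb h.symm, ?_⟩
  have hsmall : ¬ ∃ u, ReachAvoiding src tgt e (src e) u ∧
      ∀ w, ReachAvoiding src tgt e (tgt e) w → enc u < enc w :=
    fun hs => h ⟨Or.inl ⟨rfl, rfl⟩, hb, hs⟩
  push Not at hsmall
  obtain ⟨u, hu, hmin⟩ := WellFounded.has_min (InvImage.wf enc Nat.lt_wfRel.wf)
    {u | ReachAvoiding src tgt e (src e) u} ⟨_, .refl _ _ _ _⟩
  obtain ⟨w, hw, hwu⟩ := hsmall u hu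
  refine ⟨w, hw, fun v hv => ?_⟩
  have h1 : enc u ≤ enc v := not_lt.1 (hmin v hv)
  refine lt_of_le_of_ne (hwu.trans h1) fun heq => hb ?_
  rw [henc heq] at hw
  exact hv.trans hw.symm

theorem IsParent.unique (h : IsParent src tgt enc e p c) (h' : IsParent src tgt enc e' p' c) :
    p = p' := by
  obtain rfl := h.unique_edge h'
  rcases h.joins.eq_or_eq h'.joins with ⟨h1, -⟩ | ⟨h1, h2⟩
  · exact h1
  · rw [h1, h2]

end Multigraph

section Configurations

variable {G κ ι : Type} [Group G]

/-- The terminal vertex of the edge `e` in the random graph determined by `x`. -/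
def edgeTgt (σ : ι → G) (x : G × κ → ι) (e : G × κ) : G := e.1 * σ (x e)

/-- Connectedness of vertices in the graph determined by `x`, with the edge `e` removed. -/
def ConfigReach (σ : ι → G) (x : G × κ → ι) (e : G × κ) : G → G → Prop :=
  ReachAvoiding Prod.fst (edgeTgt σ x) e

/-- The group element by which a letter acts. -/
def letterVal (σ : ι → G) (l : κ × ι × Bool) : G := if l.2.2 then σ l.2.1 else (σ l.2.1)⁻¹

/-- The edge crossed by a letter read at the vertex `v`. -/
def letterEdge (σ : ι → G) (v : G) (l : κ × ι × Bool) : G × κ :=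
  (if l.2.2 then v else v * letterVal σ l, l.1)

/-- The conditions under which a word, read from the vertex `v`, is a path in the graph. -/
def constraints (σ : ι → G) : G → List (κ × ι × Bool) → List ((G × κ) × ι)
  | _, [] => []
  | v, l :: w => (letterEdge σ v l, l.2.1) :: constraints σ (v * letterVal σ l) w

theorem length_constraints (σ : ι → G) (v : G) (w : List (κ × ι × Bool)) :
    (constraints σ v w).length = w.length := by
  induction w generalizing v with
  | nil => rfl
  | cons l w ih => simp [constraints, ih]

/-- A path from `v` to `t` in the graph determined by `x`, encoded by the word `w`. -/
def IsWordPath (σ : ι → G) (x : G × κ → ι) (v t : G) (w : List (κ × ι × Bool)) : Prop :=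
  (∀ q ∈ constraints σ v w, x q.1 = q.2) ∧ v * (w.map (letterVal σ)).prod = t

theorem IsWordPath.cons {σ : ι → G} {x : G × κ → ι} {v t : G} {l : κ × ι × Bool}
    {w : List (κ × ι × Bool)} (hl : x (letterEdge σ v l) = l.2.1)
    (h : IsWordPath σ x (v * letterVal σ l) t w) : IsWordPath σ x v t (l :: w) := by
  refine ⟨fun q hq => ?_, ?_⟩
  · rcases List.mem_cons.1 hq with rfl | hq
    · exact hl
    · exact h.1 q hq
  · rw [List.map_cons, List.prod_cons, ← mul_assoc]
    exact h.2

theorem IsWordPath.head {σ : ι → G} {x : G × κ → ι} {v t : G} {l : κ × ι × Bool}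
    {w : List (κ × ι × Bool)} (h : IsWordPath σ x v t (l :: w)) :
    x (letterEdge σ v l) = l.2.1 := h.1 _ (List.mem_cons_self ..)

theorem IsWordPath.tail {σ : ι → G} {x : G × κ → ι} {v t : G} {l : κ × ι × Bool}
    {w : List (κ × ι × Bool)} (h : IsWordPath σ x v t (l :: w)) :
    IsWordPath σ x (v * letterVal σ l) t w := by
  refine ⟨fun q hq => h.1 q (List.mem_cons_of_mem _ hq), ?_⟩
  rw [← h.2, List.map_cons, List.prod_cons, mul_assoc]

theorem joins_letterEdge {σ : ι → G} {x : G × κ → ι} {v : G} {l : κ × ι × Bool}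
    (h : x (letterEdge σ v l) = l.2.1) :
    Joins Prod.fst (edgeTgt σ x) (letterEdge σ v l) v (v * letterVal σ l) := by
  unfold Joins edgeTgt
  rw [h]
  obtain ⟨i, j, b⟩ := l
  cases b <;> simp [letterEdge, letterVal]

theorem exists_letter_of_joins {σ : ι → G} {x : G × κ → ι} {e : G × κ} {u v : G}
    (h : Joins Prod.fst (edgeTgt σ x) e u v) :
    ∃ l : κ × ι × Bool, letterEdge σ u l = e ∧ x e = l.2.1 ∧ u * letterVal σ l = v := by
  obtain ⟨s, i⟩ := e
  rcases h with ⟨rfl, rfl⟩ | ⟨rfl, rfl⟩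
  · exact ⟨(i, x (s, i), true), by simp [letterEdge, letterVal, edgeTgt]⟩
  · exact ⟨(i, x (s, i), false), by simp [letterEdge, letterVal, edgeTgt]⟩

theorem IsWordPath.exists_suffix {σ : ι → G} {x : G × κ → ι} {v t : G}
    {w : List (κ × ι × Bool)} (h : IsWordPath σ x v t w) {f : G × κ}
    (hf : f ∈ (constraints σ v w).map Prod.fst) {a b : G}
    (hj : Joins Prod.fst (edgeTgt σ x) f a b) :
    ∃ w', IsWordPath σ x a t w' ∧
      ((constraints σ a w').map Prod.fst).Sublist ((constraints σ v w).map Prod.fst) := by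
  induction w generalizing v with
  | nil => simp [constraints] at hf
  | cons l w ih =>
    by_cases hfl : f = letterEdge σ v l
    · subst hfl
      rcases hj.eq_or_eq (joins_letterEdge h.head) with ⟨rfl, -⟩ | ⟨rfl, -⟩
      · exact ⟨_, h, List.Sublist.refl _⟩
      · exact ⟨w, h.tail, by simp [constraints]⟩
    · have hf' : f ∈ (constraints σ (v * letterVal σ l) w).map Prod.fst := by
        simp only [constraints, List.map_cons, List.mem_cons] at hf
        exact hf.resolve_left hfl
      obtain ⟨w', hw', hsub⟩ := ih h.tail hf'
      exact ⟨w', hw', hsub.trans (by simp [constraints])⟩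

theorem exists_wordPath_of_configReach {σ : ι → G} {x : G × κ → ι} {e : G × κ} {u v : G}
    (h : ConfigReach σ x e u v) : ∃ w, IsWordPath σ x u v w ∧
      ((constraints σ u w).map Prod.fst).Nodup ∧ e ∉ (constraints σ u w).map Prod.fst := by
  induction h using Relation.ReflTransGen.head_induction_on with
  | refl => exact ⟨[], ⟨by simp [constraints], by simp⟩, by simp [constraints], by simp [constraints]⟩
  | @head a b hab _ ih =>
    obtain ⟨f, hf, hj⟩ := hab
    obtain ⟨w, hw, hnd, he⟩ := ih
    by_cases hmem : f ∈ (constraints σ b w).map Prod.fst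
    · obtain ⟨w', hw', hsub⟩ := hw.exists_suffix hmem hj
      exact ⟨w', hw', hnd.sublist hsub, fun h => he (hsub.subset h)⟩
    · obtain ⟨l, rfl, hx, rfl⟩ := exists_letter_of_joins hj
      refine ⟨l :: w, hw.cons hx, ?_, ?_⟩
      · simp only [constraints, List.map_cons, List.nodup_cons]
        exact ⟨hmem, hnd⟩
      · simp only [constraints, List.map_cons, List.mem_cons, not_or]
        exact ⟨Ne.symm hf, he⟩

theorem exists_closed_word_of_configReach {σ : ι → G} {x : G × κ → ι} {e : G × κ}
    (h : ConfigReach σ x e e.1 (edgeTgt σ x e)) : ∃ w, w ≠ [] ∧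
      (∀ q ∈ constraints σ e.1 w, x q.1 = q.2) ∧
      ((constraints σ e.1 w).map Prod.fst).Nodup ∧ (w.map (letterVal σ)).prod = 1 := by
  obtain ⟨w, hw, hnd, he⟩ := exists_wordPath_of_configReach h.symm
  obtain ⟨l, hl, hx, hl'⟩ := exists_letter_of_joins
    (Or.inl ⟨rfl, rfl⟩ : Joins Prod.fst (edgeTgt σ x) e e.1 (edgeTgt σ x e))
  have hc : IsWordPath σ x e.1 e.1 (l :: w) := by
    refine IsWordPath.cons (by rw [hl, hx]) ?_
    rw [hl']
    exact hw
  refine ⟨l :: w, by simp, hc.1, ?_, by simpa using hc.2⟩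
  simp only [constraints, List.map_cons, List.nodup_cons, hl, hl']
  exact ⟨he, hnd⟩

end Configurations

section RandomGraph
open MeasureTheory

variable {G κ ι : Type}

/-- The uniform probability measure on the configurations. -/
noncomputable def configMeasure (G κ ι : Type) [Fintype ι] [Nonempty ι] [MeasurableSpace ι] :
    Measure (G × κ → ι) :=
  Measure.infinitePi fun _ => (PMF.uniformOfFintype ι).toMeasure

instance (G κ ι : Type) [Fintype ι] [Nonempty ι] [MeasurableSpace ι] :
    IsProbabilityMeasure (configMeasure G κ ι) := by
  unfold configMeasure
  infer_instance

theorem uniform_toMeasure_le [Fintype ι] [Nonempty ι] [MeasurableSpace ι]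
    [DiscreteMeasurableSpace ι] {s : Set ι} (hs : s.Subsingleton) :
    (PMF.uniformOfFintype ι).toMeasure s ≤ (Fintype.card ι : ENNReal)⁻¹ := by
  rcases hs.eq_empty_or_singleton with rfl | ⟨a, rfl⟩
  · simp
  · rw [PMF.toMeasure_apply_singleton _ _ .of_discrete, PMF.uniformOfFintype_apply]

theorem configMeasure_constraints_le [Fintype ι] [Nonempty ι] [MeasurableSpace ι]
    [DiscreteMeasurableSpace ι] {L : List ((G × κ) × ι)} (hL : (L.map Prod.fst).Nodup) :
    configMeasure G κ ι {x | ∀ q ∈ L, x q.1 = q.2} ≤ (Fintype.card ι : ENNReal)⁻¹ ^ L.length := by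
  classical
  have hset : {x : G × κ → ι | ∀ q ∈ L, x q.1 = q.2} =
      Set.pi ((L.map Prod.fst).toFinset : Finset (G × κ))
        fun e => {j | ∀ q ∈ L, q.1 = e → j = q.2} := by
    ext x
    simp only [Set.mem_ofPred_eq, Set.mem_pi, Finset.mem_coe, List.mem_toFinset]
    constructor
    · rintro h e - q hq rfl
      exact h q hq
    · intro h q hq
      exact h q.1 (List.mem_map_of_mem hq) q hq rfl
  rw [hset, configMeasure, Measure.infinitePi_pi _ fun e _ => .of_discrete]
  refine (Finset.prod_le_pow_card _ _ _ fun e he => uniform_toMeasure_le ?_).trans ?_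
  · simp only [List.mem_toFinset, List.mem_map] at he
    obtain ⟨q, hq, rfl⟩ := he
    intro j hj j' hj'
    rw [hj q hq rfl, hj' q hq rfl]
  · rw [List.toFinset_card_of_nodup hL, List.length_map]

variable [Group G] [MeasurableSpace G] [DiscreteMeasurableSpace G]

theorem norm_sum_letterVal_le [Fintype κ] [Fintype ι] {σ : ι → G} {c : ℝ}
    (hσ : ‖∑ i, leftReg (σ i)‖ ≤ c) :
    ‖∑ l : κ × ι × Bool, leftReg (letterVal σ l)‖ ≤ 2 * Fintype.card κ * c := by
  have h : ∑ l : κ × ι × Bool, leftReg (letterVal σ l) =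
      (Fintype.card κ : ℕ) • (∑ i, leftReg (σ i) + ∑ i, leftReg (σ i)⁻¹) := by
    rw [Fintype.sum_prod_type]
    simp only [Fintype.sum_prod_type, Fintype.sum_bool, letterVal]
    simp [Finset.sum_add_distrib]
  rw [h]
  refine (norm_nsmul_le).trans ?_
  have h2 := norm_add_le (∑ i, leftReg (σ i)) (∑ i, leftReg (σ i)⁻¹)
  rw [norm_sum_leftReg_inv] at h2
  have h3 : ‖∑ i, leftReg (σ i) + ∑ i, leftReg (σ i)⁻¹‖ ≤ 2 * c := by linarith
  have := mul_le_mul_of_nonneg_left h3 (Nat.cast_nonneg (α := ℝ) (Fintype.card κ))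
  linarith

theorem configMeasure_configReach_le [Fintype κ] [Fintype ι] [Nonempty ι] [MeasurableSpace ι]
    [DiscreteMeasurableSpace ι] {σ : ι → G} {ε : ℝ}
    (hσ : ‖∑ i, leftReg (σ i)‖ ≤ ε * Fintype.card ι) (hε : 2 * Fintype.card κ * ε ≤ 1 / 4)
    (e : G × κ) :
    configMeasure G κ ι {x | ConfigReach σ x e e.1 (edgeTgt σ x e)} ≤ 2⁻¹ := by
  let W : ℕ → Type := fun m => {w : Fin (m + 1) → κ × ι × Bool //
    (List.ofFn fun k => letterVal σ (w k)).prod = 1}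
  let S : (m : ℕ) → W m → Set (G × κ → ι) := fun m w => {x |
    ((constraints σ e.1 (List.ofFn w.1)).map Prod.fst).Nodup ∧
      ∀ q ∈ constraints σ e.1 (List.ofFn w.1), x q.1 = q.2}
  have hsub : {x | ConfigReach σ x e e.1 (edgeTgt σ x e)} ⊆ ⋃ m, ⋃ w, S m w := by
    intro x hx
    obtain ⟨w, hw0, hw1, hw2, hw3⟩ := exists_closed_word_of_configReach hx
    obtain ⟨m, hm⟩ : ∃ m, w.length = m + 1 :=
      Nat.exists_eq_succ_of_ne_zero (by simpa using hw0)
    obtain ⟨v, rfl⟩ : ∃ v : Fin (m + 1) → κ × ι × Bool, List.ofFn v = w :=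
      ⟨fun k => w.get (Fin.cast hm.symm k), by
        refine List.ext_get (by simp [hm]) fun n h1 h2 => by simp [-List.ofFn_succ]⟩
    rw [List.map_ofFn] at hw3
    exact Set.mem_iUnion.2 ⟨m, Set.mem_iUnion.2 ⟨⟨v, hw3⟩, hw2, hw1⟩⟩
  have hS : ∀ m w, configMeasure G κ ι (S m w) ≤ (Fintype.card ι : ENNReal)⁻¹ ^ (m + 1) := by
    intro m w
    by_cases hnd : ((constraints σ e.1 (List.ofFn w.1)).map Prod.fst).Nodup
    · have := configMeasure_constraints_le hnd
      rw [length_constraints, List.length_ofFn] at this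
      exact (measure_mono fun x hx => hx.2).trans this
    · have : S m w = ∅ := Set.eq_empty_of_forall_notMem fun x hx => hnd hx.1
      simp [this]
  have hn : (0 : ℝ) < Fintype.card ι := by exact_mod_cast Fintype.card_pos
  have hm : ∀ m, configMeasure G κ ι (⋃ w, S m w) ≤ ENNReal.ofReal ((1 / 4) ^ (m + 1)) := by
    intro m
    have : Fintype (W m) := Fintype.ofFinite _
    calc configMeasure G κ ι (⋃ w, S m w) ≤ ∑ w, configMeasure G κ ι (S m w) :=
          measure_iUnion_fintype_le _ _
      _ ≤ ∑ _w : W m, (Fintype.card ι : ENNReal)⁻¹ ^ (m + 1) := Finset.sum_le_sum fun w _ => hS m w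
      _ = ENNReal.ofReal (Nat.card (W m) * ((Fintype.card ι : ℝ)⁻¹ ^ (m + 1))) := by
          rw [Finset.sum_const, Finset.card_univ, ENNReal.ofReal_mul (by positivity),
            ENNReal.ofReal_pow (by positivity), ENNReal.ofReal_inv_of_pos hn,
            ENNReal.ofReal_natCast, ENNReal.ofReal_natCast, Nat.card_eq_fintype_card, nsmul_eq_mul]
      _ ≤ ENNReal.ofReal ((1 / 4) ^ (m + 1)) := by
          refine ENNReal.ofReal_le_ofReal ?_
          have h1 := card_closed_words_le (letterVal σ) (norm_sum_letterVal_le (κ := κ) hσ) (m + 1)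
          refine (mul_le_mul_of_nonneg_right h1 (by positivity)).trans ?_
          rw [← mul_pow]
          have h0 : 0 ≤ ε * Fintype.card ι := (norm_nonneg _).trans hσ
          refine pow_le_pow_left₀ (by positivity) ?_ _
          rw [← mul_assoc, mul_inv_cancel_right₀ hn.ne']
          exact hε
  calc configMeasure G κ ι {x | ConfigReach σ x e e.1 (edgeTgt σ x e)}
      ≤ configMeasure G κ ι (⋃ m, ⋃ w, S m w) := measure_mono hsub
    _ ≤ ∑' m, configMeasure G κ ι (⋃ w, S m w) := measure_iUnion_le _
    _ ≤ ∑' m : ℕ, ENNReal.ofReal ((1 / 4) ^ (m + 1)) := ENNReal.tsum_le_tsum hm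
    _ = ENNReal.ofReal (∑' m : ℕ, (1 / 4) ^ (m + 1)) :=
        (ENNReal.ofReal_tsum_of_nonneg (fun m => by positivity)
          ((summable_nat_add_iff 1).2 (summable_geometric_of_lt_one (by norm_num) (by norm_num)))).symm
    _ ≤ 2⁻¹ := by
        simp only [pow_succ]
        rw [tsum_mul_right, tsum_geometric_of_lt_one (by norm_num) (by norm_num)]
        rw [← ENNReal.ofReal_ofNat, ← ENNReal.ofReal_inv_of_pos (by norm_num)]
        exact ENNReal.ofReal_le_ofReal (by norm_num)

end RandomGraph

section ArcField
open MeasureTheory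

variable {G κ ι : Type} [Group G]

/-- The shift of configurations. -/
def configShift (g : G) (x : G × κ → ι) : G × κ → ι := fun p => x (g⁻¹ * p.1, p.2)

theorem configShift_one (x : G × κ → ι) : configShift 1 x = x := by
  funext p
  simp [configShift]

theorem configShift_mul (g h : G) (x : G × κ → ι) :
    configShift (g * h) x = configShift g (configShift h x) := by
  funext p
  simp [configShift, mul_assoc]

theorem edgeTgt_configShift (σ : ι → G) (g : G) (x : G × κ → ι) (e : G × κ) :
    edgeTgt σ (configShift g x) (g * e.1, e.2) = g * edgeTgt σ x e := by
  simp [edgeTgt, configShift, mul_assoc]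

theorem measurePreserving_configShift [Fintype ι] [Nonempty ι] [MeasurableSpace ι] (g : G) :
    MeasurePreserving (configShift g) (configMeasure G κ ι) (configMeasure G κ ι) := by
  have hm : Measurable (configShift g : (G × κ → ι) → _) :=
    measurable_pi_lambda _ fun p => measurable_pi_apply _
  refine ⟨hm, ?_⟩
  have h := Measure.infinitePi_map_piCongrLeft
    (fun _ : G × κ => (PMF.uniformOfFintype ι).toMeasure)
    ((Equiv.mulLeft g).prodCongr (Equiv.refl κ))
  unfold configMeasure
  convert h using 2
  funext x p
  obtain ⟨p, rfl⟩ := ((Equiv.mulLeft g).prodCongr (Equiv.refl κ)).surjective p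
  have := MeasurableEquiv.piCongrLeft_apply_apply ((Equiv.mulLeft g).prodCongr (Equiv.refl κ))
    (β := fun _ => ι) x p
  rw [this]
  simp [configShift]

/-- The arcs `s → t` given by the bridges with initial vertex `s`. -/
def bridgeArc (σ : ι → G) (s t : G) : Set (G × κ → ι) :=
  {x | ∃ i, edgeTgt σ x (s, i) = t ∧ ¬ ConfigReach σ x (s, i) s t}

/-- The arcs `s → t` given by the bridges with initial vertex `s` that point away from the
side with the smallest label. -/
def parentArc (σ : ι → G) (enc : G → ℕ) (s t : G) : Set (G × κ → ι) :=
  {x | ∃ i, edgeTgt σ x (s, i) = t ∧ IsParent Prod.fst (edgeTgt σ x) enc (s, i) s t}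

theorem parentArc_subset (σ : ι → G) (enc : G → ℕ) (s t : G) :
    parentArc (κ := κ) σ enc s t ⊆ bridgeArc σ s t := fun _ ⟨i, h, h'⟩ => ⟨i, h, h'.bridge⟩

theorem parentArc_unique {σ : ι → G} {enc : G → ℕ} {s s' t : G} {x : G × κ → ι}
    (h : x ∈ parentArc σ enc s t) (h' : x ∈ parentArc σ enc s' t) : s = s' := by
  obtain ⟨i, -, h⟩ := h
  obtain ⟨i', -, h'⟩ := h'
  exact h.unique h'

theorem bridgeArc_diff_unique {σ : ι → G} {enc : G → ℕ} (henc : Function.Injective enc)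
    {s t t' : G} {x : G × κ → ι} (h : x ∈ bridgeArc σ s t \ parentArc σ enc s t)
    (h' : x ∈ bridgeArc σ s t' \ parentArc σ enc s t') : t = t' := by
  have key : ∀ t, x ∈ bridgeArc σ s t \ parentArc σ enc s t →
      ∃ i, IsParent Prod.fst (edgeTgt σ x) enc ((s, i) : G × κ) t s := by
    rintro _ ⟨⟨i, rfl, hb⟩, hn⟩
    exact ⟨i, isParent_or_isParent henc hb fun hp => hn ⟨i, rfl, hp⟩⟩
  obtain ⟨i, h1⟩ := key t h
  obtain ⟨i', h2⟩ := key t' h'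
  exact h1.unique h2

theorem bridgeArc_configShift_of_mem {σ : ι → G} {g s t : G} {x : G × κ → ι}
    (h : configShift g x ∈ bridgeArc σ (g * s) (g * t)) : x ∈ bridgeArc σ s t := by
  obtain ⟨i, hi, hr⟩ := h
  refine ⟨i, ?_, fun hreach => hr ?_⟩
  · rw [edgeTgt_configShift σ g x (s, i)] at hi
    exact mul_left_cancel hi
  · exact ReachAvoiding.map (fV := (g * ·)) (fE := fun e : G × κ => (g * e.1, e.2))
      (fun e e' h => by simpa [Prod.ext_iff] using h) (fun e => rfl)
      (edgeTgt_configShift σ g x) hreach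

theorem configShift_mem_bridgeArc {σ : ι → G} {g s t : G} {x : G × κ → ι} :
    configShift g x ∈ bridgeArc σ (g * s) (g * t) ↔ x ∈ bridgeArc σ s t := by
  refine ⟨bridgeArc_configShift_of_mem, fun h => ?_⟩
  refine bridgeArc_configShift_of_mem (g := g⁻¹) ?_
  rwa [← configShift_mul, inv_mul_cancel, configShift_one, inv_mul_cancel_left,
    inv_mul_cancel_left]

theorem measurable_reflTransGen {X V : Type} [MeasurableSpace X] [Countable V]
    {r : X → V → V → Prop} (hr : ∀ u v, Measurable fun x => r x u v) (u v : V) :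
    Measurable fun x => Relation.ReflTransGen (r x) u v := by
  let P : ℕ → X → V → Prop := fun n => n.rec (fun _ v => u = v) fun _ p x v => ∃ w, p x w ∧ r x w v
  have hP : ∀ n v, Measurable fun x => P n x v := by
    intro n
    induction n with
    | zero => exact fun v => measurable_const
    | succ n ih => exact fun v => Measurable.exists fun w => (ih w).and (hr w v)
  have h : (fun x => Relation.ReflTransGen (r x) u v) = fun x => ∃ n, P n x v := by
    funext x
    refine propext ⟨fun h => ?_, ?_⟩
    · induction h with
      | refl => exact ⟨0, rfl⟩
      | tail _ h ih =>
        obtain ⟨n, hn⟩ := ih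
        exact ⟨n + 1, _, hn, h⟩
    · rintro ⟨n, hn⟩
      induction n generalizing v with
      | zero =>
        obtain rfl : u = v := hn
        exact .refl
      | succ n ih =>
        obtain ⟨w, hw, hr⟩ := hn
        exact (ih w hw).tail hr
  rw [h]
  exact Measurable.exists fun n => hP n v

section Measurability
variable [MeasurableSpace ι] [DiscreteMeasurableSpace ι] (σ : ι → G)

theorem measurable_edgeTgt_eq (e : G × κ) (t : G) : Measurable fun x => edgeTgt σ x e = t :=
  (Measurable.of_discrete (f := fun j => e.1 * σ j = t)).comp (measurable_pi_apply e)

theorem measurable_joins (e : G × κ) (u v : G) :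
    Measurable fun x => Joins Prod.fst (edgeTgt σ x) e u v :=
  ((measurable_const).and (measurable_edgeTgt_eq σ e v)).or
    ((measurable_const).and (measurable_edgeTgt_eq σ e u))

variable [Countable G] [Finite κ]

theorem measurable_configReach (e : G × κ) (u v : G) :
    Measurable fun x => ConfigReach σ x e u v :=
  measurable_reflTransGen (fun a b => Measurable.exists fun f =>
    measurable_const.and (measurable_joins σ f a b)) u v

theorem measurableSet_bridgeArc (s t : G) : MeasurableSet (bridgeArc (κ := κ) σ s t) :=
  measurableSet_setOfPred.2 <| Measurable.exists fun i => (measurable_edgeTgt_eq σ (s, i) t).and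
    (measurable_configReach σ (s, i) s t).not

theorem measurableSet_parentArc (enc : G → ℕ) (s t : G) :
    MeasurableSet (parentArc (κ := κ) σ enc s t) := by
  refine measurableSet_setOfPred.2 <| Measurable.exists fun i =>
    (measurable_edgeTgt_eq σ (s, i) t).and ?_
  have h : (fun x : G × κ → ι => IsParent Prod.fst (edgeTgt σ x) enc (s, i) s t) = fun x =>
      Joins Prod.fst (edgeTgt σ x) (s, i) s t ∧ ¬ ConfigReach σ x (s, i) s t ∧
        ∃ u, ConfigReach σ x (s, i) s u ∧ ∀ w, ConfigReach σ x (s, i) t w → enc u < enc w :=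
    funext fun x => propext ⟨fun h => ⟨h.1, h.2, h.3⟩, fun h => ⟨h.1, h.2.1, h.2.2⟩⟩
  rw [h]
  exact (measurable_joins σ _ _ _).and <| (measurable_configReach σ _ _ _).not.and <|
    Measurable.exists fun u => (measurable_configReach σ _ _ _).and <| Measurable.forall fun w =>
      (measurable_configReach σ _ _ _).imp measurable_const

end Measurability

variable [Countable G] [MeasurableSpace G] [DiscreteMeasurableSpace G] [Fintype κ] [Fintype ι]
  [Nonempty ι] [MeasurableSpace ι] [DiscreteMeasurableSpace ι] [DecidableEq G]

theorem le_sum_configMeasure_bridgeArc {σ : ι → G} {ε : ℝ}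
    (hσ : ‖∑ i, leftReg (σ i)‖ ≤ ε * Fintype.card ι) (hε : 2 * Fintype.card κ * ε ≤ 1 / 4) :
    (Fintype.card κ : ENNReal) * 2⁻¹ ≤
      ∑ u ∈ Finset.univ.image σ, configMeasure G κ ι (bridgeArc σ 1 u) := by
  let B : κ → G → Set (G × κ → ι) := fun i u =>
    {x | edgeTgt σ x (1, i) = u ∧ ¬ ConfigReach σ x (1, i) 1 u}
  have hBm : ∀ i u, MeasurableSet (B i u) := fun i u => measurableSet_setOfPred.2 <|
    (measurable_edgeTgt_eq σ (1, i) u).and (measurable_configReach σ (1, i) 1 u).not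
  have h1 : ∀ i, (2⁻¹ : ENNReal) ≤ ∑ u ∈ Finset.univ.image σ, configMeasure G κ ι (B i u) := by
    intro i
    have hb := configMeasure_configReach_le hσ hε ((1, i) : G × κ)
    have hsub : (⋃ u ∈ Finset.univ.image σ, B i u)ᶜ ⊆
        {x | ConfigReach σ x ((1, i) : G × κ) 1 (edgeTgt σ x (1, i))} := by
      intro x hx
      by_contra hn
      refine hx (Set.mem_iUnion₂.2 ⟨edgeTgt σ x (1, i), ?_, rfl, hn⟩)
      exact Finset.mem_image.2 ⟨x (1, i), Finset.mem_univ _, by simp [edgeTgt]⟩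
    have h := (measure_mono hsub).trans hb
    rw [prob_compl_eq_one_sub (Finset.measurableSet_biUnion _ fun u _ => hBm i u)] at h
    refine le_trans ?_ (measure_biUnion_finset_le _ _)
    have h2 := tsub_le_iff_left.1 h
    refine (ENNReal.add_le_add_iff_right (a := 2⁻¹) (by simp)).1 ?_
    rwa [ENNReal.inv_two_add_inv_two]
  have h2 : ∀ u, ∑ i, configMeasure G κ ι (B i u) ≤ configMeasure G κ ι (bridgeArc σ 1 u) := by
    intro u
    rw [← tsum_fintype (L := .unconditional _), ← measure_iUnion ?_ fun i => hBm i u]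
    · exact measure_mono (Set.iUnion_subset fun i x hx => ⟨i, hx⟩)
    · intro i j hij
      refine Set.disjoint_left.2 fun x hx hx' => hx.2 ?_
      exact .of_joins (f := (1, j)) (fun h => hij (Prod.ext_iff.1 h).2.symm)
        (Or.inl ⟨rfl, hx'.1⟩)
  calc (Fintype.card κ : ENNReal) * 2⁻¹ = ∑ _i : κ, (2⁻¹ : ENNReal) := by
        rw [Finset.sum_const, Finset.card_univ, nsmul_eq_mul]
    _ ≤ ∑ i, ∑ u ∈ Finset.univ.image σ, configMeasure G κ ι (B i u) :=
        Finset.sum_le_sum fun i _ => h1 i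
    _ = ∑ u ∈ Finset.univ.image σ, ∑ i, configMeasure G κ ι (B i u) := Finset.sum_comm
    _ ≤ _ := Finset.sum_le_sum fun u _ => h2 u

end ArcField

section KernelOperators
open MeasureTheory

theorem WeightedMap.op_sub {Ω : Type*} [MeasurableSpace Ω] {μ : Measure Ω}
    {w w₁ w₂ : WeightedMap μ} (hφ : ∀ x, w.φ x = w₁.φ x - w₂.φ x) (h₁ : ∀ x, w₁.q x = w.q x)
    (h₂ : ∀ x, w₂.q x = w.q x) : w.op = w₁.op - w₂.op := by
  ext1 f
  refine Lp.ext ?_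
  filter_upwards [w.coeFn_op f, w₁.coeFn_op f, w₂.coeFn_op f,
    Lp.coeFn_sub (w₁.op f) (w₂.op f)] with x h h1 h2 h3
  rw [_root_.sub_apply, h3, Pi.sub_apply, h, h1, h2, hφ, h₁, h₂, sub_mul]

variable {G X : Type} [Group G] [MeasurableSpace X] [MeasurableSpace G] [DiscreteMeasurableSpace G]

/-- Right translation of the second variable by `u`. -/
def rightShift (X : Type) [MeasurableSpace X] (u : G) : X × G ≃ᵐ X × G :=
  (MeasurableEquiv.refl X).prodCongr ⟨Equiv.mulRight u, .of_discrete, .of_discrete⟩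

theorem rightShift_apply (u : G) (z : X × G) : rightShift X u z = (z.1, z.2 * u) := rfl

variable [Countable G] {μ : Measure X} [IsProbabilityMeasure μ]

theorem measurePreserving_rightShift (μ : Measure X) [IsProbabilityMeasure μ] (u : G) :
    MeasurePreserving (rightShift X u) (μ.prod Measure.count) (μ.prod Measure.count) :=
  (MeasurePreserving.id μ).prod (measurePreserving_count_equiv (Equiv.mulRight u))

/-- The operator `f ↦ ((x, s) ↦ k (x, s) * f (x, s * u))`. -/
noncomputable def shiftTerm (μ : Measure X) [IsProbabilityMeasure μ] (u : G) {k : X × G → ℂ}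
    (hk : Measurable k) (hb : ∀ z, ‖k z‖ ≤ 1) : WeightedMap (μ.prod (Measure.count : Measure G)) where
  φ := k
  q := rightShift X u
  measurable_weight := hk
  bdd := ⟨1, hb⟩
  mp := measurePreserving_rightShift μ u

theorem norm_sq_sum_mul_le {α : Type*} (T : Finset α) (a b : α → ℂ) :
    ‖∑ u ∈ T, a u * b u‖ ^ 2 ≤ (∑ u ∈ T, ‖a u‖) * ∑ u ∈ T, ‖a u‖ * ‖b u‖ ^ 2 := by
  have h1 : ‖∑ u ∈ T, a u * b u‖ ≤ ∑ u ∈ T, ‖a u‖ * ‖b u‖ :=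
    (norm_sum_le _ _).trans_eq (Finset.sum_congr rfl fun u _ => norm_mul _ _)
  refine (pow_le_pow_left₀ (norm_nonneg _) h1 2).trans ?_
  refine Finset.sum_sq_le_sum_mul_sum_of_sq_le_mul T (fun u _ => norm_nonneg _)
    (fun u _ => by positivity) fun u _ => (by ring : _ = _).le

theorem norm_sum_shiftTerm_le (T : Finset G) {k : G → X × G → ℂ} (hk : ∀ u, Measurable (k u))
    (hb : ∀ u z, ‖k u z‖ ≤ 1) {c : ℝ} (hc : 0 ≤ c) (hrow : ∀ z, ∑ u ∈ T, ‖k u z‖ ≤ c)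
    (hcol : ∀ z, ∑ u ∈ T, ‖k u (rightShift X u⁻¹ z)‖ ≤ c) :
    ‖∑ u ∈ T, (shiftTerm μ u (hk u) (hb u)).op‖ ≤ c := by
  set ν := μ.prod (Measure.count : Measure G)
  refine ContinuousLinearMap.opNorm_le_bound _ hc fun f => ?_
  have hint0 : Integrable (fun z => ‖f z‖ ^ 2) ν :=
    (memLp_two_iff_integrable_sq_norm (Lp.memLp f).1).1 (Lp.memLp f)
  have hint1 : ∀ u, Integrable (fun z => ‖k u z‖ * ‖f (rightShift X u z)‖ ^ 2) ν := fun u =>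
    ((measurePreserving_rightShift μ u).integrable_comp_of_integrable hint0).bdd_mul (c := 1)
      (hk u).norm.aestronglyMeasurable (ae_of_all _ fun z => by simpa using hb u z)
  have hint2 : ∀ u, Integrable (fun z => ‖k u (rightShift X u⁻¹ z)‖ * ‖f z‖ ^ 2) ν := fun u =>
    hint0.bdd_mul (c := 1) ((hk u).comp (rightShift X u⁻¹).measurable).norm.aestronglyMeasurable
      (ae_of_all _ fun z => by simpa using hb u _)
  have hchange : ∀ u, ∫ z, ‖k u z‖ * ‖f (rightShift X u z)‖ ^ 2 ∂ν =
      ∫ z, ‖k u (rightShift X u⁻¹ z)‖ * ‖f z‖ ^ 2 ∂ν := fun u => by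
    rw [← (measurePreserving_rightShift μ u).integral_comp
      (rightShift X u).measurableEmbedding fun z => ‖k u (rightShift X u⁻¹ z)‖ * ‖f z‖ ^ 2]
    simp only [rightShift_apply, mul_inv_cancel_right]
    rfl
  have hval : (∑ u ∈ T, (shiftTerm μ u (hk u) (hb u)).op) f =ᵐ[ν]
      fun z => ∑ u ∈ T, k u z * f (rightShift X u z) := by
    rw [_root_.sum_apply]
    refine (Lp.coeFn_finsetSum _ _).trans ?_
    have : ∀ u ∈ T, ∀ᵐ z ∂ν, (shiftTerm μ u (hk u) (hb u)).op f z =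
        k u z * f (rightShift X u z) := fun u _ => (shiftTerm μ u (hk u) (hb u)).coeFn_op f
    filter_upwards [(Finset.eventually_all T).2 this] with z hz
    rw [Finset.sum_apply]
    exact Finset.sum_congr rfl hz
  refine le_of_sq_le_sq ?_ (by positivity)
  have hf : ∫ z, ‖f z‖ ^ 2 ∂ν = ‖f‖ ^ 2 := integral_norm_sq_eq f
  rw [← integral_norm_sq_eq, mul_pow, ← hf]
  calc ∫ z, ‖((∑ u ∈ T, (shiftTerm μ u (hk u) (hb u)).op) f) z‖ ^ 2 ∂ν
      ≤ ∫ z, c * ∑ u ∈ T, ‖k u z‖ * ‖f (rightShift X u z)‖ ^ 2 ∂ν := by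
        refine integral_mono_of_nonneg (ae_of_all _ fun z => by positivity)
          ((integrable_finsetSum _ fun u _ => hint1 u).const_mul c) ?_
        filter_upwards [hval] with z hz
        rw [hz]
        exact (norm_sq_sum_mul_le T _ _).trans
          (mul_le_mul_of_nonneg_right (hrow z) (Finset.sum_nonneg fun u _ => by positivity))
    _ = c * ∫ z, ∑ u ∈ T, ‖k u (rightShift X u⁻¹ z)‖ * ‖f z‖ ^ 2 ∂ν := by
        rw [integral_const_mul, integral_finsetSum _ fun u _ => hint1 u,
          integral_finsetSum _ fun u _ => hint2 u, Finset.sum_congr rfl fun u _ => hchange u]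
    _ ≤ c * ∫ z, c * ‖f z‖ ^ 2 ∂ν := by
        refine mul_le_mul_of_nonneg_left (integral_mono
          (integrable_finsetSum _ fun u _ => hint2 u) (hint0.const_mul c) fun z => ?_) hc
        simp only [← Finset.sum_mul]
        exact mul_le_mul_of_nonneg_right (hcol z) (by positivity)
    _ = c ^ 2 * ∫ z, ‖f z‖ ^ 2 ∂ν := by rw [integral_const_mul]; ring

end KernelOperators

section ArcOperators
open MeasureTheory

theorem sum_indicator_one_le_one {α X : Type*} (T : Finset α) (C : α → Set X) (x : X)
    (h : ∀ u v, x ∈ C u → x ∈ C v → u = v) : ∑ u ∈ T, (C u).indicator (1 : X → ℝ) x ≤ 1 := by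
  classical
  by_cases hx : ∃ u, x ∈ C u
  · obtain ⟨u, hu⟩ := hx
    have h0 : ∀ v, v ≠ u → (C v).indicator (1 : X → ℝ) x = 0 := fun v hv =>
      Set.indicator_of_notMem (fun hv' => hv (h _ _ hv' hu)) _
    by_cases hT : u ∈ T
    · rw [Finset.sum_eq_single_of_mem u hT fun v _ hv => h0 v hv]
      simp [hu]
    · rw [Finset.sum_eq_zero fun v hv => h0 v fun e => hT (e ▸ hv)]
      exact zero_le_one
  · push Not at hx
    rw [Finset.sum_eq_zero fun v _ => Set.indicator_of_notMem (hx v) _]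
    exact zero_le_one

theorem norm_indicator_sub_indicator_le_one {X : Type} (A B : Set X) (x : X) :
    ‖A.indicator (1 : X → ℂ) x - B.indicator 1 x‖ ≤ 1 := by
  by_cases h : x ∈ A <;> by_cases h' : x ∈ B <;> simp [h, h']

theorem norm_indicator_sub_indicator_le {X : Type} {A B C D : Set X} {x : X}
    (h₁ : x ∈ A → x ∉ B → x ∈ C ∨ x ∈ D) (h₂ : x ∈ B → x ∉ A → x ∈ C ∨ x ∈ D) :
    ‖A.indicator (1 : X → ℂ) x - B.indicator 1 x‖ ≤
      C.indicator (1 : X → ℝ) x + D.indicator 1 x := by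
  by_cases h : x ∈ A <;> by_cases h' : x ∈ B <;> by_cases h3 : x ∈ C <;> by_cases h4 : x ∈ D <;>
    simp_all

section ArcTranslate
variable {G X : Type} [Group G] [MulAction G X]

/-- The translate of a random directed graph by `g`. -/
def arcTranslate (g : G) (F : G → G → Set X) (s t : G) : Set X :=
  (fun x => g⁻¹ • x) ⁻¹' F (g⁻¹ * s) (g⁻¹ * t)

theorem mem_arcTranslate {g : G} {F : G → G → Set X} {s t : G} {x : X} :
    x ∈ arcTranslate g F s t ↔ g⁻¹ • x ∈ F (g⁻¹ * s) (g⁻¹ * t) := Iff.rfl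

theorem measurableSet_arcTranslate [MeasurableSpace X] [MeasurableConstSMul G X] (g : G) {F : G → G → Set X}
    (hF : ∀ s t, MeasurableSet (F s t)) (s t : G) : MeasurableSet (arcTranslate g F s t) :=
  measurable_const_smul _ (hF _ _)

end ArcTranslate

variable {G X : Type} [Group G]

/-- The indicator of the arcs `s → s * u` of the directed graph `F`. -/
noncomputable def arcWeight (F : G → G → Set X) (u : G) (z : X × G) : ℂ :=
  (F z.2 (z.2 * u)).indicator 1 z.1

theorem norm_arcWeight_le (F : G → G → Set X) (u : G) (z : X × G) : ‖arcWeight F u z‖ ≤ 1 :=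
  norm_indicator_one_le _ _

variable [MeasurableSpace X] [MeasurableSpace G] [DiscreteMeasurableSpace G] [Countable G]

theorem measurable_arcWeight {F : G → G → Set X} (hF : ∀ s t, MeasurableSet (F s t)) (u : G) :
    Measurable (arcWeight F u) :=
  measurable_from_prod_countable_left fun s => measurable_one.indicator (hF s (s * u))

/-- The adjacency operator of a random directed graph `F` on `G`, with steps restricted to the
finite set `T`. -/
noncomputable def arcOp (μ : Measure X) [IsProbabilityMeasure μ] {F : G → G → Set X}
    (hF : ∀ s t, MeasurableSet (F s t)) (T : Finset G) :
    Lp ℂ 2 (μ.prod (Measure.count : Measure G)) →L[ℂ]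
      Lp ℂ 2 (μ.prod (Measure.count : Measure G)) :=
  ∑ u ∈ T, (shiftTerm μ u (measurable_arcWeight hF u) (norm_arcWeight_le F u)).op

variable (μ : Measure X) [IsProbabilityMeasure μ]

theorem commute_arcOp_fstMul {F : G → G → Set X} (hF : ∀ s t, MeasurableSet (F s t))
    (T : Finset G) {φ : X → ℂ} (hφ : Measurable φ) (hb : ∃ C, ∀ x, ‖φ x‖ ≤ C) :
    Commute (arcOp μ hF T) (fstMul μ G hφ hb) := by
  refine Commute.sum_left _ _ _ fun u _ => ?_
  unfold Commute SemiconjBy fstMul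
  rw [WeightedMap.op_mul, WeightedMap.op_mul]
  exact WeightedMap.op_congr (fun z => mul_comm _ _) fun z => rfl

theorem arcOp_sub {F F' : G → G → Set X} (hF : ∀ s t, MeasurableSet (F s t))
    (hF' : ∀ s t, MeasurableSet (F' s t)) (h : ∀ s t, F' s t ⊆ F s t) (T : Finset G) :
    arcOp μ (fun s t => (hF s t).diff (hF' s t)) T = arcOp μ hF T - arcOp μ hF' T := by
  unfold arcOp
  rw [← Finset.sum_sub_distrib]
  refine Finset.sum_congr rfl fun u _ => WeightedMap.op_sub (fun z => ?_) (fun z => rfl) fun z => rfl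
  exact congrFun (Set.indicator_sdiff (h _ _) 1) z.1

theorem norm_arcOp_sub_arcOp_le {A A' M : G → G → Set X} (hA : ∀ s t, MeasurableSet (A s t))
    (hA' : ∀ s t, MeasurableSet (A' s t)) (hAM : ∀ s t, A s t ⊆ M s t)
    (hAM' : ∀ s t, A' s t ⊆ M s t)
    (h₁ : ∀ s s' t x, x ∈ A s t → x ∈ A s' t → s = s')
    (h₁' : ∀ s s' t x, x ∈ A' s t → x ∈ A' s' t → s = s')
    (h₂ : ∀ s t t' x, x ∈ M s t \ A s t → x ∈ M s t' \ A s t' → t = t')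
    (h₂' : ∀ s t t' x, x ∈ M s t \ A' s t → x ∈ M s t' \ A' s t' → t = t') (T : Finset G) :
    ‖arcOp μ hA T - arcOp μ hA' T‖ ≤ 2 := by
  have he : arcOp μ hA T - arcOp μ hA' T = ∑ u ∈ T, (shiftTerm μ u
      ((measurable_arcWeight hA u).sub (measurable_arcWeight hA' u))
      fun _ => norm_indicator_sub_indicator_le_one _ _ _).op := by
    unfold arcOp
    rw [← Finset.sum_sub_distrib]
    refine Finset.sum_congr rfl fun u _ => Eq.symm ?_
    exact WeightedMap.op_sub (fun z => rfl) (fun z => rfl) fun z => rfl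
  rw [he]
  refine norm_sum_shiftTerm_le T _ _ zero_le_two (fun z => ?_) fun z => ?_
  · refine (Finset.sum_le_sum fun u _ => norm_indicator_sub_indicator_le
      (C := M z.2 (z.2 * u) \ A z.2 (z.2 * u)) (D := M z.2 (z.2 * u) \ A' z.2 (z.2 * u))
      (fun h h' => .inr ⟨hAM _ _ h, h'⟩) fun h h' => .inl ⟨hAM' _ _ h, h'⟩).trans ?_
    rw [Finset.sum_add_distrib, ← one_add_one_eq_two]
    exact add_le_add
      (sum_indicator_one_le_one _ _ _ fun u v hu hv => mul_left_cancel (h₂ _ _ _ _ hu hv))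
      (sum_indicator_one_le_one _ _ _ fun u v hu hv => mul_left_cancel (h₂' _ _ _ _ hu hv))
  · refine (Finset.sum_le_sum fun u _ => norm_indicator_sub_indicator_le
      (C := A (z.2 * u⁻¹) z.2) (D := A' (z.2 * u⁻¹) z.2)
      (fun h _ => ?_) fun h _ => ?_).trans ?_
    · simp only [rightShift_apply, inv_mul_cancel_right] at h
      exact .inl h
    · simp only [rightShift_apply, inv_mul_cancel_right] at h
      exact .inr h
    · rw [Finset.sum_add_distrib, ← one_add_one_eq_two]
      exact add_le_add
        (sum_indicator_one_le_one _ _ _ fun u v hu hv =>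
          inv_injective (mul_left_cancel (h₁ _ _ _ _ hu hv)))
        (sum_indicator_one_le_one _ _ _ fun u v hu hv =>
          inv_injective (mul_left_cancel (h₁' _ _ _ _ hu hv)))

variable [MulAction G X] [MeasurableConstSMul G X] [SMulInvariantMeasure G X μ]

theorem koopman_mul_arcOp (g : G) {F : G → G → Set X} (hF : ∀ s t, MeasurableSet (F s t))
    (T : Finset G) : koopman μ g * arcOp μ hF T =
      arcOp μ (measurableSet_arcTranslate g hF) T * koopman μ g := by
  unfold arcOp koopman
  rw [Finset.mul_sum, Finset.sum_mul]
  refine Finset.sum_congr rfl fun u _ => ?_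
  rw [WeightedMap.op_mul, WeightedMap.op_mul]
  refine WeightedMap.op_congr (fun z => ?_) fun z => ?_
  · simp only [WeightedMap.comp, WeightedMap.ofMap, shiftTerm, arcWeight, one_mul, mul_one,
      mul_assoc]
    rfl
  · simp [WeightedMap.comp, WeightedMap.ofMap, shiftTerm, rightShift_apply, mul_assoc]

theorem commute_arcOp_koopman {M : G → G → Set X} (hM : ∀ s t, MeasurableSet (M s t))
    (hinv : ∀ g s t x, g • x ∈ M (g * s) (g * t) ↔ x ∈ M s t) (T : Finset G) (g : G) :
    Commute (arcOp μ hM T) (koopman μ g) := by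
  have h : arcTranslate g M = M := by
    ext s t x
    rw [mem_arcTranslate, hinv]
  have h' := koopman_mul_arcOp μ g hM T
  simp only [h] at h'
  exact h'.symm

theorem norm_arcOp_mul_wreathRep_sub_le {A Y : Type} [CommGroup A]
    [MeasurableSpace Y] [DiscreteMeasurableSpace Y] {χ : Y → A →* ℂ}
    (hχ : ∀ y a, ‖χ y a‖ = 1) {y : G → X → Y} (hy : ∀ t, Measurable (y t))
    (hye : ∀ g t x, y t (g • x) = y (g⁻¹ * t) x)
    {P M : G → G → Set X} (hP : ∀ s t, MeasurableSet (P s t))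
    (hinv : ∀ g s t x, g • x ∈ M (g * s) (g * t) ↔ x ∈ M s t) (hPM : ∀ s t, P s t ⊆ M s t)
    (h₁ : ∀ s s' t x, x ∈ P s t → x ∈ P s' t → s = s')
    (h₂ : ∀ s t t' x, x ∈ M s t \ P s t → x ∈ M s t' \ P s t' → t = t') (T : Finset G)
    (w : Wreath A G) : ‖arcOp μ hP T * wreathRep μ hχ hy hye w -
      wreathRep μ hχ hy hye w * arcOp μ hP T‖ ≤ 2 := by
  set g := w.right
  have hmem : ∀ s t x, x ∈ M s t → g⁻¹ • x ∈ M (g⁻¹ * s) (g⁻¹ * t) := fun s t x h =>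
    (hinv _ _ _ _).2 h
  have hle := norm_arcOp_sub_arcOp_le (M := M) μ hP (measurableSet_arcTranslate g hP) hPM
    (fun s t x hx => (hinv g⁻¹ s t x).1 (hPM _ _ hx)) h₁
    (fun s s' t x h h' => mul_left_cancel (h₁ _ _ _ _ h h')) h₂
    (fun s t t' x h h' => mul_left_cancel (h₂ _ _ _ _ ⟨hmem _ _ _ h.1, h.2⟩
      ⟨hmem _ _ _ h'.1, h'.2⟩)) T
  rw [wreathRep_apply, ← mul_assoc, (commute_arcOp_fstMul μ hP T _ _).eq, mul_assoc, mul_assoc,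
    ← mul_sub, koopman_mul_arcOp, ← sub_mul]
  have hK := norm_koopman_le μ g
  have hF := norm_fstMul_le μ G (measurable_characterProd χ hy w.left) zero_le_one
    fun x => (norm_characterProd hχ y w.left x).le
  calc _ ≤ _ := norm_mul_le _ _
    _ ≤ 1 * (2 * 1) := mul_le_mul hF ((norm_mul_le _ _).trans
        (mul_le_mul hle hK (norm_nonneg _) zero_le_two)) (norm_nonneg _) zero_le_one
    _ = 2 := by norm_num

end ArcOperators

theorem norm_sq_eq_of_inner_self {E : Type*} [NormedAddCommGroup E] [InnerProductSpace ℂ E] {f : E}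
    {r : ℝ} (h : inner ℂ f f = (r : ℂ)) : ‖f‖ ^ 2 = r := by
  have h2 := inner_self_eq_norm_sq (𝕜 := ℂ) f
  rw [h] at h2
  exact h2.symm

section PointVectors
open MeasureTheory

theorem sum_measureReal_le_one {α X : Type*} [MeasurableSpace X] (μ : Measure X)
    [IsProbabilityMeasure μ] (T : Finset α) {C : α → Set X} (hC : ∀ u, MeasurableSet (C u))
    (h : ∀ u v x, x ∈ C u → x ∈ C v → u = v) : ∑ u ∈ T, μ.real (C u) ≤ 1 := by
  rw [← measureReal_biUnion_finset (fun u _ v _ huv => Set.disjoint_left.2 fun x hu hv =>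
    huv (h u v x hu hv)) fun u _ => hC u]
  exact measureReal_le_one

theorem fstInd_inner {G X : Type} [MeasurableSpace X] [MeasurableSpace G] (μ : Measure X) {C : Set X} (hC : MeasurableSet C)
    (f h : Lp ℂ 2 (μ.prod (Measure.count : Measure G))) :
    inner ℂ (fstInd μ G hC f) h = inner ℂ f (fstInd μ G hC h) := by
  rw [← inner_conj_symm, inner_fstInd, inner_fstInd, ← integral_conj]
  simp only [inner_conj_symm]

variable {G X : Type} [MeasurableSpace X] [MeasurableSpace G]
  [DiscreteMeasurableSpace G] [Countable G] (μ : Measure X) [IsProbabilityMeasure μ]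

theorem prod_count_ne_top (C : Set X) (t : G) :
    (μ.prod (Measure.count : Measure G)) (C ×ˢ {t}) ≠ ⊤ := by
  simp

/-- The indicator function of `C × {t}` as an element of `L²(X × G)`. -/
noncomputable def pointVec {C : Set X} (hC : MeasurableSet C) (t : G) :
    Lp ℂ 2 (μ.prod (Measure.count : Measure G)) :=
  indicatorConstLp 2 (hC.prod (measurableSet_singleton t))
    (prod_count_ne_top μ C t) 1

theorem coeFn_pointVec {C : Set X} (hC : MeasurableSet C) (t : G) :
    pointVec μ hC t =ᵐ[μ.prod Measure.count] (C ×ˢ {t}).indicator fun _ => 1 :=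
  indicatorConstLp_coeFn

theorem pointVec_congr {C D : Set X} {hC : MeasurableSet C} {hD : MeasurableSet D} {s t : G}
    (h : C = D) (hst : s = t) : pointVec μ hC s = pointVec μ hD t := by
  subst h hst; rfl

theorem inner_pointVec_left {C : Set X} (hC : MeasurableSet C) (t : G)
    (f : Lp ℂ 2 (μ.prod (Measure.count : Measure G))) :
    inner ℂ (pointVec μ hC t) f = ∫ z in C ×ˢ {t}, f z ∂μ.prod Measure.count :=
  L2.inner_indicatorConstLp_one _ _ _

theorem inner_pointVec_self {C : Set X} (hC : MeasurableSet C) (t : G) :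
    inner ℂ (pointVec μ hC t) (pointVec μ hC t) = (μ.real C : ℂ) := by
  unfold pointVec
  rw [L2.inner_indicatorConstLp_one_indicatorConstLp_one _ _ (prod_count_ne_top μ _ _) (prod_count_ne_top μ _ _), Set.inter_self, measureReal_prod_prod]
  simp [measureReal_def]

theorem inner_pointVec_of_ne {C D : Set X} (hC : MeasurableSet C) (hD : MeasurableSet D) {s t : G}
    (h : s ≠ t) : inner ℂ (pointVec μ hC s) (pointVec μ hD t) = 0 := by
  unfold pointVec
  rw [L2.inner_indicatorConstLp_one_indicatorConstLp_one _ _ (prod_count_ne_top μ _ _) (prod_count_ne_top μ _ _), Set.prod_inter_prod,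
    Set.singleton_inter_eq_empty.2 (by simpa using h), Set.prod_empty]
  simp

theorem norm_sum_pointVec_sq {α : Type*} (T : Finset α) {C : α → Set X}
    (hC : ∀ u, MeasurableSet (C u)) {t : α → G} (ht : Function.Injective t) :
    ‖∑ u ∈ T, pointVec μ (hC u) (t u)‖ ^ 2 = ∑ u ∈ T, μ.real (C u) := by
  have h : (inner ℂ (∑ u ∈ T, pointVec μ (hC u) (t u)) (∑ u ∈ T, pointVec μ (hC u) (t u)) : ℂ) =
      ((∑ u ∈ T, μ.real (C u) : ℝ) : ℂ) := by
    rw [sum_inner, Complex.ofReal_sum]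
    refine Finset.sum_congr rfl fun u hu => ?_
    rw [inner_sum, Finset.sum_eq_single_of_mem u hu fun v _ hv =>
      inner_pointVec_of_ne μ _ _ fun e => hv (ht e).symm, inner_pointVec_self]
  exact norm_sq_eq_of_inner_self h

theorem fstInd_pointVec {C D : Set X} (hC : MeasurableSet C) (hD : MeasurableSet D) (t : G) :
    fstInd μ G hD (pointVec μ hC t) = pointVec μ (hD.inter hC) t := by
  refine Lp.ext ?_
  filter_upwards [coeFn_fstInd hD (pointVec μ hC t), coeFn_pointVec μ hC t,
    coeFn_pointVec μ (hD.inter hC) t] with z h1 h2 h3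
  rw [h1, h2, h3]
  by_cases hz : z.1 ∈ D <;> by_cases hz' : z.1 ∈ C <;> by_cases hz2 : z.2 = t <;>
    simp [hz, hz', hz2, Set.indicator]

variable [Group G]

theorem arcOp_pointVec {F : G → G → Set X} (hF : ∀ s t, MeasurableSet (F s t)) (T : Finset G) :
    arcOp μ hF T (pointVec μ MeasurableSet.univ 1) =
      ∑ u ∈ T, pointVec μ (hF u⁻¹ 1) u⁻¹ := by
  unfold arcOp
  rw [_root_.sum_apply]
  refine Finset.sum_congr rfl fun u _ => Lp.ext ?_
  filter_upwards [WeightedMap.coeFn_op _ (pointVec μ MeasurableSet.univ (1 : G)),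
    (measurePreserving_rightShift μ u).quasiMeasurePreserving.ae
      (coeFn_pointVec μ MeasurableSet.univ (1 : G)),
    coeFn_pointVec μ (hF u⁻¹ 1) u⁻¹] with z h1 h2 h3
  rw [h1, h3]
  change arcWeight F u z * pointVec μ MeasurableSet.univ 1 (rightShift X u z) = _
  rw [h2, rightShift_apply]
  obtain ⟨x, s⟩ := z
  by_cases hs : s = u⁻¹
  · subst hs
    by_cases hx : x ∈ F u⁻¹ 1 <;> simp [arcWeight, hx]
  · simp [hs, mul_eq_one_iff_eq_inv]

theorem inner_pointVec_arcOp {F : G → G → Set X} (hF : ∀ s t, MeasurableSet (F s t))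
    (T : Finset G) (f : Lp ℂ 2 (μ.prod (Measure.count : Measure G))) :
    inner ℂ (pointVec μ MeasurableSet.univ 1) (arcOp μ hF T f) =
      inner ℂ (∑ u ∈ T, pointVec μ (hF 1 u) u) f := by
  unfold arcOp
  rw [_root_.sum_apply, inner_sum, sum_inner]
  refine Finset.sum_congr rfl fun u _ => ?_
  have hB : MeasurableSet (F 1 u ×ˢ {u}) := (hF 1 u).prod (measurableSet_singleton u)
  rw [inner_pointVec_left, inner_pointVec_left,
    ← (measurePreserving_rightShift μ u).setIntegral_preimage_emb
      (rightShift X u).measurableEmbedding (fun z => f z),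
    ← integral_indicator (MeasurableSet.univ.prod (measurableSet_singleton 1)),
    ← integral_indicator ((rightShift X u).measurable hB)]
  refine integral_congr_ae ?_
  filter_upwards [WeightedMap.coeFn_op
    (shiftTerm μ u (measurable_arcWeight hF u) (norm_arcWeight_le F u)) f] with z h1
  obtain ⟨x, s⟩ := z
  replace h1 : _ = arcWeight F u (x, s) * f (x, s * u) := h1
  by_cases hs : s = 1
  · subst hs
    by_cases hx : x ∈ F 1 u
    · simp [Set.indicator, h1, hx, rightShift_apply, arcWeight]
    · simp [Set.indicator, h1, hx, rightShift_apply, arcWeight]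
  · simp [Set.indicator, hs, rightShift_apply]

variable [MulAction G X] [MeasurableConstSMul G X] [SMulInvariantMeasure G X μ]

theorem koopman_pointVec_univ (t : G) :
    koopman μ t (pointVec μ MeasurableSet.univ 1) = pointVec μ MeasurableSet.univ t := by
  refine Lp.ext ?_
  filter_upwards [WeightedMap.coeFn_op _ (pointVec μ MeasurableSet.univ (1 : G)),
    (measurePreserving_diagonal μ t).quasiMeasurePreserving.ae
      (coeFn_pointVec μ MeasurableSet.univ (1 : G)),
    coeFn_pointVec μ MeasurableSet.univ t] with z h1 h2 h3
  refine h1.trans ?_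
  rw [h3]
  change 1 * pointVec μ MeasurableSet.univ (1 : G) (t⁻¹ • z.1, t⁻¹ * z.2) = _
  rw [h2]
  by_cases hs : z.2 = t
  · simp [Set.indicator, hs]
  · simp [Set.indicator, hs, inv_mul_eq_one, Ne.symm hs]

theorem pointVec_eq {C : Set X} (hC : MeasurableSet C) (t : G) : pointVec μ hC t =
    fstInd μ G hC (koopman μ t (pointVec μ MeasurableSet.univ 1)) := by
  rw [koopman_pointVec_univ, fstInd_pointVec]
  exact pointVec_congr μ (Set.inter_univ C).symm rfl

theorem koopman_mul_fstInd (g : G) {C : Set X} (hC : MeasurableSet C) :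
    koopman μ g * fstInd μ G hC =
      fstInd μ G (measurable_const_smul g⁻¹ hC) * koopman μ g := by
  unfold koopman fstInd fstMul
  rw [WeightedMap.op_mul, WeightedMap.op_mul]
  exact WeightedMap.op_congr (fun z => mul_comm _ _) fun z => rfl

theorem inner_koopman_inv (g : G) (f h : Lp ℂ 2 (μ.prod (Measure.count : Measure G))) :
    inner ℂ (koopman μ g⁻¹ f) h = inner ℂ f (koopman μ g h) := by
  have hle : ∀ (g : G) (f : Lp ℂ 2 (μ.prod (Measure.count : Measure G))),
      ‖koopman μ g f‖ ≤ ‖f‖ := fun g f =>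
    ((koopman μ g).le_of_opNorm_le (norm_koopman_le μ g) f).trans_eq (one_mul _)
  have hinv : ∀ (g : G) (f : Lp ℂ 2 (μ.prod (Measure.count : Measure G))),
      koopman μ g (koopman μ g⁻¹ f) = f := fun g f => by
    rw [← mul_apply_eq_comp, ← koopman_mul, mul_inv_cancel, koopman_one, one_apply_eq_self]
  have hn : ∀ f, ‖(koopman μ g).toLinearMap f‖ = ‖f‖ := fun f => by
    refine le_antisymm (hle g f) ?_
    have := hle g⁻¹ (koopman μ g f)
    have h2 := hinv g⁻¹ f
    rw [inv_inv] at h2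
    rwa [h2] at this
  have := (LinearIsometry.mk (koopman μ g).toLinearMap hn).inner_map_map (koopman μ g⁻¹ f) h
  rw [← this]
  change inner ℂ (koopman μ g (koopman μ g⁻¹ f)) (koopman μ g h) = _
  rw [hinv]

theorem inner_apply_sum_pointVec {M : G → G → Set X} (hM : ∀ s t, MeasurableSet (M s t))
    (hinv : ∀ g s t x, g • x ∈ M (g * s) (g * t) ↔ x ∈ M s t) (T : Finset G)
    {R : Lp ℂ 2 (μ.prod (Measure.count : Measure G)) →L[ℂ]
      Lp ℂ 2 (μ.prod (Measure.count : Measure G))}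
    (hRK : ∀ g : G, Commute R (koopman μ g))
    (hRQ : ∀ (C : Set X) (hC : MeasurableSet C), Commute R (fstInd μ G hC)) :
    inner ℂ (pointVec μ MeasurableSet.univ 1) (R (∑ u ∈ T, pointVec μ (hM 1 u) u)) =
      inner ℂ (∑ u ∈ T, pointVec μ (hM u⁻¹ 1) u⁻¹) (R (pointVec μ MeasurableSet.univ 1)) := by
  have hQ : ∀ (C : Set X) (hC : MeasurableSet C) f, R (fstInd μ G hC f) = fstInd μ G hC (R f) :=
    fun C hC f => congrArg (· f) (hRQ C hC).eq
  have hK : ∀ (g : G) f, R (koopman μ g f) = koopman μ g (R f) :=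
    fun g f => congrArg (· f) (hRK g).eq
  rw [map_sum, inner_sum, sum_inner]
  refine Finset.sum_congr rfl fun u _ => ?_
  have hset : (fun x : X => u⁻¹ • x) ⁻¹' M u⁻¹ 1 = M 1 u := by
    ext x
    have := hinv u⁻¹ 1 u x
    rwa [mul_one, inv_mul_cancel] at this
  rw [pointVec_eq μ (hM 1 u), pointVec_eq μ (hM u⁻¹ 1), hQ, hK, fstInd_inner, inner_koopman_inv,
    ← mul_apply_eq_comp (koopman μ u) (fstInd μ G _), koopman_mul_fstInd, mul_apply_eq_comp]
  simp only [hset]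

theorem sum_measureReal_le_of_commute {M P : G → G → Set X} (hM : ∀ s t, MeasurableSet (M s t))
    (hP : ∀ s t, MeasurableSet (P s t)) (hPM : ∀ s t, P s t ⊆ M s t)
    (hinv : ∀ g s t x, g • x ∈ M (g * s) (g * t) ↔ x ∈ M s t)
    (h₁ : ∀ s s' t x, x ∈ P s t → x ∈ P s' t → s = s')
    (h₂ : ∀ s t t' x, x ∈ M s t \ P s t → x ∈ M s t' \ P s t' → t = t') (T : Finset G)
    {B : Lp ℂ 2 (μ.prod (Measure.count : Measure G)) →L[ℂ]
      Lp ℂ 2 (μ.prod (Measure.count : Measure G))} {K : ℝ} (hB : ‖B‖ ≤ K)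
    (hBK : ∀ g : G, Commute (arcOp μ hP T - B) (koopman μ g))
    (hBQ : ∀ (C : Set X) (hC : MeasurableSet C), Commute (arcOp μ hP T - B) (fstInd μ G hC)) :
    ∑ u ∈ T, μ.real (M 1 u) ≤ (2 + 2 * K) ^ 2 := by
  set ξ : Lp ℂ 2 (μ.prod (Measure.count : Measure G)) := pointVec μ MeasurableSet.univ 1
  set E := ∑ u ∈ T, μ.real (M 1 u)
  have hK0 : 0 ≤ K := (norm_nonneg B).trans hB
  have hE0 : 0 ≤ E := Finset.sum_nonneg fun u _ => measureReal_nonneg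
  set η := ∑ u ∈ T, pointVec μ (hM 1 u) u
  set θ := ∑ u ∈ T, pointVec μ (hM u⁻¹ 1) u⁻¹
  have hξ : ‖ξ‖ ≤ 1 := by
    have := inner_pointVec_self μ (MeasurableSet.univ (α := X)) (1 : G)
    refine (sq_le_one_iff₀ (norm_nonneg _)).1 ((norm_sq_eq_of_inner_self this).trans_le ?_)
    exact measureReal_le_one
  have hη : ‖η‖ ^ 2 = E := norm_sum_pointVec_sq μ T (fun u => hM 1 u) Function.injective_id
  have hθ : ‖θ‖ ^ 2 = E := by
    refine (norm_sum_pointVec_sq μ T (fun u => hM u⁻¹ 1) inv_injective).trans ?_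
    refine Finset.sum_congr rfl fun u _ => ?_
    rw [measureReal_def, measureReal_def, ← measure_preimage_smul μ u⁻¹ (M u⁻¹ 1)]
    congr 2
    ext x
    have := hinv u⁻¹ 1 u x
    rwa [mul_one, inv_mul_cancel] at this
  have hD := arcOp_sub μ hM hP hPM T
  set D := arcOp μ (fun s t => (hM s t).diff (hP s t)) T
  set ζ := ∑ u ∈ T, pointVec μ ((hM 1 u).diff (hP 1 u)) u
  have hζ : ‖ζ‖ ≤ 1 := by
    have := norm_sum_pointVec_sq μ T (fun u => (hM 1 u).diff (hP 1 u)) Function.injective_id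
    refine (sq_le_one_iff₀ (norm_nonneg _)).1 (this.trans_le ?_)
    exact sum_measureReal_le_one μ T (fun u => (hM 1 u).diff (hP 1 u)) fun u v x => h₂ 1 u v x
  have hPξ : ‖arcOp μ hP T ξ‖ ≤ 1 := by
    rw [arcOp_pointVec]
    have := norm_sum_pointVec_sq μ T (fun u => hP u⁻¹ 1) inv_injective
    refine (sq_le_one_iff₀ (norm_nonneg _)).1 (this.trans_le ?_)
    exact sum_measureReal_le_one μ T (fun u => hP u⁻¹ 1) fun u v x h h' =>
      inv_injective (h₁ _ _ 1 x h h')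
  have hR := inner_apply_sum_pointVec (R := arcOp μ hM T - (arcOp μ hP T - B)) μ hM hinv T
    (fun g => (commute_arcOp_koopman μ hM hinv T g).sub_left (hBK g))
    fun C hC => (commute_arcOp_fstMul μ hM T _ _).sub_left (hBQ C hC)
  have hRe : arcOp μ hM T - (arcOp μ hP T - B) = D + B := by rw [hD]; abel
  have hθθ : (E : ℂ) = inner ℂ ζ η + inner ℂ ξ (B η) + inner ℂ θ (arcOp μ hP T ξ) -
      inner ℂ θ (B ξ) := by
    have h1 : (E : ℂ) = inner ℂ θ θ := by
      rw [inner_self_eq_norm_sq_to_K, ← hθ]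
      norm_cast
    have h2 : inner ℂ ζ η + inner ℂ ξ (B η) = inner ℂ θ θ - inner ℂ θ (arcOp μ hP T ξ) +
        inner ℂ θ (B ξ) := by
      rw [← inner_pointVec_arcOp μ (fun s t => (hM s t).diff (hP s t)), ← inner_add_right, ← add_apply, ← hRe]
      refine hR.trans ?_
      rw [_root_.sub_apply, _root_.sub_apply, inner_sub_right, inner_sub_right, arcOp_pointVec]
      ring
    rw [h1, h2]
    ring
  have hBle : ∀ f, ‖B f‖ ≤ K * ‖f‖ := B.le_of_opNorm_le hB
  have hηθ : ‖η‖ = ‖θ‖ := by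
    rw [← abs_norm η, ← abs_norm θ, ← sq_eq_sq_iff_abs_eq_abs, hη, hθ]
  have hmain : E ≤ (2 + 2 * K) * ‖θ‖ := by
    have h3 : ‖inner ℂ ζ η‖ ≤ 1 * ‖θ‖ := (norm_inner_le_norm _ _).trans
      (mul_le_mul hζ hηθ.le (norm_nonneg _) zero_le_one)
    have h4 : ‖inner ℂ ξ (B η)‖ ≤ 1 * (K * ‖θ‖) := (norm_inner_le_norm _ _).trans
      (mul_le_mul hξ (hηθ ▸ hBle η) (norm_nonneg _) zero_le_one)
    have h5 : ‖inner ℂ θ (arcOp μ hP T ξ)‖ ≤ ‖θ‖ * 1 := (norm_inner_le_norm _ _).trans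
      (mul_le_mul_of_nonneg_left hPξ (norm_nonneg _))
    have h6 : ‖inner ℂ θ (B ξ)‖ ≤ ‖θ‖ * (K * 1) := (norm_inner_le_norm _ _).trans
      (mul_le_mul_of_nonneg_left ((hBle ξ).trans (mul_le_mul_of_nonneg_left hξ hK0))
        (norm_nonneg _))
    have h7 : E = ‖(E : ℂ)‖ := by rw [Complex.norm_real, Real.norm_of_nonneg hE0]
    rw [h7, hθθ]
    refine (norm_sub_le _ _).trans ((add_le_add_left ((norm_add_le _ _).trans
      (add_le_add_left (norm_add_le _ _) _)) _).trans ?_)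
    linarith
  have h8 : ‖θ‖ ≤ 2 + 2 * K := by
    rcases (norm_nonneg θ).eq_or_lt with h | h
    · rw [← h]; positivity
    · rw [← hθ, sq] at hmain
      exact le_of_mul_le_mul_right hmain h
  rw [← hθ]
  exact pow_le_pow_left₀ (norm_nonneg _) h8 2

end PointVectors

section BernoulliAction
open MeasureTheory

/-- The shift action of `G` on configurations. -/
@[reducible] def configAction (G κ ι : Type) [Group G] : MulAction G (G × κ → ι) where
  smul := configShift
  one_smul := configShift_one
  mul_smul := configShift_mul

theorem measurableSet_of_columns {G κ ι : Type} [Finite κ] [Finite ι] [MeasurableSpace ι]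
    {C : Set (G × κ → ι)} (hC : MeasurableSet C) (m : MeasurableSpace (G × κ → ι))
    (hm : ∀ (t : G) (c : κ → ι), MeasurableSet[m] ((fun x i => x (t, i)) ⁻¹' {c})) :
    MeasurableSet[m] C := by
  have hle : MeasurableSpace.pi ≤ m := by
    refine iSup_le fun p => ?_
    rintro _ ⟨S, -, rfl⟩
    have h : (fun x : G × κ → ι => x p) ⁻¹' S =
        ⋃ c ∈ {c : κ → ι | c p.2 ∈ S}, (fun (x : G × κ → ι) i => x (p.1, i)) ⁻¹' {c} := by
      ext x
      simp
    rw [h]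
    exact MeasurableSet.biUnion (Set.to_countable _) fun c _ => hm p.1 c
  exact hle C hC

theorem exists_derivation_of_not_isAmenable {G : Type} [Group G] [Countable G] (hG : ¬ IsAmenable G) (A : Type)
    [CommGroup A] [Infinite A] (d : ℕ) :
    ∃ (H : Type) (_ : NormedAddCommGroup H) (_ : InnerProductSpace ℂ H) (_ : CompleteSpace H)
      (ρ : Wreath A G →* (H →L[ℂ] H)) (T : H →L[ℂ] H), (∀ w, ‖ρ w‖ ≤ 1) ∧
      (∀ w, ‖T * ρ w - ρ w * T‖ ≤ 2) ∧
      ∀ (K : ℝ) (B : H →L[ℂ] H), ‖B‖ ≤ K → (∀ w, T * ρ w - ρ w * T = B * ρ w - ρ w * B) →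
        (d : ℝ) / 2 ≤ (2 + 2 * K) ^ 2 := by
  classical
  let _ : MeasurableSpace G := ⊤
  have hdG : DiscreteMeasurableSpace G := ⟨fun _ => trivial⟩
  obtain ⟨ι, _, _, σ, hσ⟩ := exists_norm_sum_leftReg_le hG
    (ε := 1 / (8 * ((d : ℝ) + 1))) (by positivity)
  let _ : MeasurableSpace ι := ⊤
  have hdι : DiscreteMeasurableSpace ι := ⟨fun _ => trivial⟩
  have hε : 2 * (Fintype.card (Fin d) : ℝ) * (1 / (8 * ((d : ℝ) + 1))) ≤ 1 / 4 := by
    rw [Fintype.card_fin, mul_one_div, div_le_div_iff₀ (by positivity) (by norm_num)]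
    linarith
  let _ : MulAction G (G × Fin d → ι) := configAction G (Fin d) ι
  let μ := configMeasure G (Fin d) ι
  have hcs : MeasurableConstSMul G (G × Fin d → ι) :=
    ⟨fun g => (measurePreserving_configShift g).measurable⟩
  have hinvμ : SMulInvariantMeasure G (G × Fin d → ι) μ :=
    ⟨fun g s hs => (measurePreserving_configShift g).measure_preimage hs.nullMeasurableSet⟩
  obtain ⟨enc, henc⟩ := exists_injective_nat G
  obtain ⟨χ, hinj, hχ⟩ := exists_characters A (Fin d → ι)
  let y : G → (G × Fin d → ι) → Fin d → ι := fun t x i => x (t, i)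
  have hy : ∀ t, Measurable (y t) := fun t =>
    measurable_pi_lambda _ fun i => measurable_pi_apply _
  have hye : ∀ g t x, y t (g • x) = y (g⁻¹ * t) x := fun g t x => rfl
  have hM := measurableSet_bridgeArc (κ := Fin d) σ
  have hP := measurableSet_parentArc (κ := Fin d) σ enc
  have hPM := parentArc_subset (κ := Fin d) σ enc
  have hinv : ∀ (g s t : G) (x : G × Fin d → ι),
      g • x ∈ bridgeArc σ (g * s) (g * t) ↔ x ∈ bridgeArc σ s t :=
    fun g s t x => configShift_mem_bridgeArc
  have h₁ : ∀ (s s' t : G) (x : G × Fin d → ι), x ∈ parentArc σ enc s t →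
      x ∈ parentArc σ enc s' t → s = s' := fun s s' t x => parentArc_unique
  have h₂ : ∀ (s t t' : G) (x : G × Fin d → ι), x ∈ bridgeArc σ s t \ parentArc σ enc s t →
      x ∈ bridgeArc σ s t' \ parentArc σ enc s t' → t = t' :=
    fun s t t' x => bridgeArc_diff_unique henc
  let T := arcOp μ hP (Finset.univ.image σ)
  refine ⟨Lp ℂ 2 (μ.prod (Measure.count : Measure G)), inferInstance, inferInstance, inferInstance,
    wreathRep μ hχ hy hye, T, norm_wreathRep_le μ hχ hy hye,
    norm_arcOp_mul_wreathRep_sub_le μ hχ hy hye hP hinv hPM h₁ h₂ _, fun K B hB hTB => ?_⟩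
  have hcomm : ∀ w, Commute (T - B) (wreathRep μ hχ hy hye w) := fun w => by
    have h := hTB w
    unfold Commute SemiconjBy
    rw [sub_mul, mul_sub]
    rw [sub_eq_sub_iff_add_eq_add] at h ⊢
    rw [add_comm] at h
    rw [add_comm, h, add_comm]
  have hle := sum_measureReal_le_of_commute μ hM hP hPM hinv h₁ h₂ _ hB
    (commute_koopman_of_commute_wreathRep hχ hy hye hcomm)
    fun C hC => commute_fstInd_of_commute_wreathRep hχ hinj hy hye
      (fun C hC m hm => measurableSet_of_columns hC m hm) hcomm hC
  refine le_trans ?_ hle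
  have hge := le_sum_configMeasure_bridgeArc (κ := Fin d) hσ hε
  have hge' := ENNReal.toReal_mono
    (ENNReal.sum_ne_top.2 fun u _ => measure_ne_top _ _) hge
  rw [ENNReal.toReal_sum fun u _ => measure_ne_top _ _] at hge'
  have he : ((Fintype.card (Fin d) : ENNReal) * 2⁻¹).toReal = (d : ℝ) / 2 := by
    simp [div_eq_mul_inv]
  exact he ▸ hge'

end BernoulliAction

theorem isAmenable_of_isUnitarizableGroup_wreath {G A : Type} [Group G] [Countable G] [CommGroup A]
    [Infinite A] (h : IsUnitarizableGroup (Wreath A G)) : IsAmenable G := by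
  by_contra hG
  choose H i₁ i₂ i₃ ρ T hρ hT hlow using exists_derivation_of_not_isAmenable hG A
  obtain ⟨K, hK⟩ := h.exists_uniform_bound ρ hρ T hT
  obtain ⟨d, hd⟩ := exists_nat_gt (2 * (2 + 2 * K) ^ 2)
  obtain ⟨B, hB, hB'⟩ := hK d
  have := hlow d K B hB hB'
  linarith

/-- **Monod–Ozawa.**  For a countable discrete group `G` the following are
equivalent: (i) `G` is amenable; (ii) `A ≀ G` is unitarizable for some infinite
abelian group `A`; (iii) `A ≀ G` is unitarizable for all amenable groups `A`. -/
theorem statement19 (G : Type) [Group G] [Countable G] :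
    (IsAmenable G ↔
      ∃ (A : Type) (_ : CommGroup A), Infinite A ∧ IsUnitarizableGroup (Wreath A G)) ∧
    (IsAmenable G ↔
      ∀ (A : Type) [Group A], IsAmenable A → IsUnitarizableGroup (Wreath A G)) := by
  have h₁ : IsAmenable G → ∀ (A : Type) [Group A], IsAmenable A →
      IsUnitarizableGroup (Wreath A G) := fun hG A _ hA => (hA.wreath hG).isUnitarizableGroup
  have h₂ : (∀ (A : Type) [Group A], IsAmenable A → IsUnitarizableGroup (Wreath A G)) →
      ∃ (A : Type) (_ : CommGroup A), Infinite A ∧ IsUnitarizableGroup (Wreath A G) := fun h =>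
    ⟨Multiplicative ℤ, inferInstance, inferInstance, h _ isAmenable_multiplicative_int⟩
  have h₃ : (∃ (A : Type) (_ : CommGroup A), Infinite A ∧ IsUnitarizableGroup (Wreath A G)) →
      IsAmenable G := fun ⟨_, _, _, h⟩ => isAmenable_of_isUnitarizableGroup_wreath h
  exact ⟨⟨fun h => h₂ (h₁ h), h₃⟩, ⟨h₁, fun h => h₃ (h₂ h)⟩⟩
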